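/- arXiv:1706.08816 — 3 statements merged into one kernel-verified Lean document; each statement's English description precedes it below -/
import Mathlib

section
/- Let d ≥ 2 be an integer, let r and r' be purely imaginary, let 0 < t < 2/3 be real, and let 0 < δ < t/4. Then Ψ^d(r,r',t) = ((2π)^{4−3t}/(2^d π²)) · [Γ(d−1+2t−r−r') Γ(d−1+t+r+r') Γ(2−3t/2) Γ(t/2−r−r') Γ(t+r+r')] / [Γ(d−1+3t/2) Γ(3t/2)] × (2π)^{−3} ∫_{ℝ³} G(δ+iu₁, δ+iu₂, δ+iu₃) du₁ du₂ du₃, where G(s₁,s₂,s₃) := Γ(s₁)Γ(s₂)Γ(s₃) Γ(d−1+3t/2−s₂) Γ(3t/2−s₃) Γ(2−3t/2+s₁)^{−1} × [ Γ((d−1)/2+t+r−2r'−s₁−s₂) Γ((d−1)/2+2t+2r−r'−s₁−s₂−s₃) / (Γ((d−1)/2+2t+2r−r'−s₁−s₂) Γ((d−1+5t)/2+r−2r'−s₁−s₂−s₃)) + Γ((d−1)/2+t+r'−2r−s₁−s₂) Γ((d−1)/2+2t+2r'−r−s₁−s₂−s₃) / (Γ((d−1)/2+2t+2r'−r−s₁−s₂)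 Γ((d−1+5t)/2+r'−2r−s₁−s₂−s₃)) ]. -/
open Complex Real Set MeasureTheory Finset

/-- The beta function `B(u,v) = Γ(u)Γ(v)/Γ(u+v)`. -/
noncomputable def cBeta (u v : ℂ) : ℂ := Complex.Gamma u * Complex.Gamma v / Complex.Gamma (u + v)

/-- The completed Whittaker function `W^{d*}_{m'}(y, r)`, defined via its Mellin-Barnes
integral with the contours placed at `σ₁ = σ₂ = 1`. -/
noncomputable def Wstar (d : ℕ) (r : ℂ) (y₁ y₂ : ℝ) (m' : ℤ) : ℂ :=
  ((2 : ℂ) ^ (d + 1) * (Real.pi : ℂ))⁻¹ *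
    (Real.sqrt ((2 * d).choose (d + m'.natAbs)) : ℂ) *
    ∑ ℓ ∈ Finset.range (m'.natAbs + 1),
      (if 0 ≤ m' then (1 : ℂ) else -1) ^ ℓ * ((m'.natAbs).choose ℓ : ℂ) *
        (((2 * Real.pi : ℝ) : ℂ))⁻¹ ^ 2 *
          ∫ t : ℝ × ℝ,
            ((2 * Real.pi * y₁ : ℝ) : ℂ) ^ (1 - ((1 : ℂ) + Complex.I * t.1)) *
              ((2 * Real.pi * y₂ : ℝ) : ℂ) ^ (1 - ((1 : ℂ) + Complex.I * t.2)) *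
                Complex.Gamma (((d : ℂ) - 1) / 2 + ((1 : ℂ) + Complex.I * t.1) - r) *
                  Complex.Gamma (((d : ℂ) - 1) / 2 + ((1 : ℂ) + Complex.I * t.2) + r) *
                    cBeta (((d : ℂ) - (m'.natAbs : ℂ) + ((1 : ℂ) + Complex.I * t.1) + 2 * r) / 2)
                      (((ℓ : ℂ) + ((1 : ℂ) + Complex.I * t.2) - 2 * r) / 2)

/-- The Rankin-Selberg local zeta integral `Ψ^d(r, r', t)`. -/
noncomputable def Psi (d : ℕ) (r r' t : ℂ) : ℂ :=
  ∫ y₁ in Set.Ioi (0 : ℝ), ∫ y₂ in Set.Ioi (0 : ℝ),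
    (∑ m' ∈ Finset.Icc (-(d : ℤ)) (d : ℤ), Wstar d r y₁ y₂ m' * Wstar d r' y₁ y₂ m') *
      ((y₁ ^ 2 * y₂ : ℝ) : ℂ) ^ t / ((y₁ * y₂ : ℝ) : ℂ) ^ 3

theorem ofReal_cpow_eq_cexp {x : ℝ} (hx : 0 < x) (z : ℂ) :
    (x : ℂ) ^ z = cexp (Real.log x * z) := by
  rw [Complex.cpow_def_of_ne_zero (by exact_mod_cast hx.ne'), Complex.ofReal_log hx.le]

theorem norm_Gamma_le_Gamma_re {s : ℂ} (hs : 0 < s.re) : ‖Complex.Gamma s‖ ≤ Real.Gamma s.re := by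
  rw [Complex.Gamma_eq_integral hs, Complex.GammaIntegral, Real.Gamma_eq_integral hs]
  refine (norm_integral_le_integral_norm _).trans_eq (setIntegral_congr_fun measurableSet_Ioi ?_)
  intro x hx
  simp only [norm_mul, norm_real, norm_cpow_eq_rpow_re_of_pos hx]
  simp [abs_of_pos (Real.exp_pos _)]

theorem exists_norm_Gamma_le {σ : ℝ} (hσ : 0 < σ) :
    ∃ C, ∀ s : ℂ, s.re = σ → ‖Complex.Gamma s‖ ≤ C * (1 + s.im ^ 2)⁻¹ := by
  set m := min (σ ^ 2) 1 with hm
  have hm0 : 0 < m := by positivity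
  refine ⟨Real.Gamma (σ + 2) / m, fun s hs => ?_⟩
  have h0 : s ≠ 0 := by rintro rfl; simp at hs; linarith
  have h1 : s + 1 ≠ 0 := by
    intro h
    have := congrArg Complex.re h
    simp at this; linarith
  have hΓ : Complex.Gamma (s + 1 + 1) = (s + 1) * (s * Complex.Gamma s) := by
    rw [Complex.Gamma_add_one _ h1, Complex.Gamma_add_one _ h0]
  have hb : ‖Complex.Gamma (s + 1 + 1)‖ ≤ Real.Gamma (σ + 2) := by
    have := norm_Gamma_le_Gamma_re (s := s + 1 + 1) (by simp; linarith)
    convert this using 2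
    simp [hs]; ring
  have hs2 : ‖s‖ ^ 2 = σ ^ 2 + s.im ^ 2 := by
    rw [← Complex.normSq_eq_norm_sq, Complex.normSq_apply, hs]; ring
  have hs3 : ‖s + 1‖ ^ 2 = (σ + 1) ^ 2 + s.im ^ 2 := by
    rw [← Complex.normSq_eq_norm_sq, Complex.normSq_apply]; simp [hs]; ring
  have hle : ‖s‖ ≤ ‖s + 1‖ := by
    apply le_of_sq_le_sq _ (norm_nonneg _)
    rw [hs2, hs3]; nlinarith
  have hmain : m * (1 + s.im ^ 2) ≤ ‖s + 1‖ * ‖s‖ := by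
    have h1 : m * (1 + s.im ^ 2) ≤ ‖s‖ ^ 2 := by
      rw [hs2]
      have := min_le_left (σ ^ 2) 1
      have := min_le_right (σ ^ 2) 1
      nlinarith [sq_nonneg s.im]
    nlinarith [norm_nonneg s]
  rw [hΓ, norm_mul, norm_mul, ← mul_assoc] at hb
  rw [div_mul_eq_mul_div, le_div_iff₀ hm0, ← div_eq_mul_inv, le_div_iff₀ (by positivity)]
  calc ‖Complex.Gamma s‖ * m * (1 + s.im ^ 2) = (m * (1 + s.im ^ 2)) * ‖Complex.Gamma s‖ := by ring
    _ ≤ _ := by gcongr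
    _ ≤ _ := hb

theorem continuous_Gamma_vertical {z : ℂ} {α : Type*} [TopologicalSpace α] {f : α → ℂ}
    (hf : Continuous f) (hz : 0 < z.re) (h : ∀ a, (f a).re = z.re) :
    Continuous fun a => Complex.Gamma (f a) := by
  rw [continuous_iff_continuousAt]
  intro a
  refine ContinuousAt.comp (g := Complex.Gamma) ?_ hf.continuousAt
  refine (Complex.differentiableAt_Gamma _ fun m hm => ?_).continuousAt
  have := h a
  rw [hm] at this
  simp at this
  linarith [this, (Nat.cast_nonneg m : (0 : ℝ) ≤ m)]

theorem integrable_Gamma_vertical {z : ℂ} (hz : 0 < z.re) :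
    Integrable fun u : ℝ => Complex.Gamma (z + I * u) := by
  obtain ⟨C, hC⟩ := exists_norm_Gamma_le hz
  have hi : Integrable fun u : ℝ => C * (1 + (u + z.im) ^ 2)⁻¹ :=
    (integrable_inv_one_add_sq.comp_add_right z.im).const_mul C
  refine hi.mono' (continuous_Gamma_vertical (z := z) (by fun_prop) hz
    (by simp)).aestronglyMeasurable (.of_forall fun u => ?_)
  simpa [add_comm] using hC (z + I * u) (by simp)

theorem integral_Ioo_beta {a b : ℂ} (ha : 0 < a.re) (hb : 0 < b.re) :
    IntegrableOn (fun x : ℝ => (x : ℂ) ^ (a - 1) * (1 - (x : ℂ)) ^ (b - 1)) (Set.Ioo 0 1) ∧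
    ∫ x in Set.Ioo (0 : ℝ) 1, (x : ℂ) ^ (a - 1) * (1 - (x : ℂ)) ^ (b - 1) =
      Complex.Gamma a * Complex.Gamma b / Complex.Gamma (a + b) := by
  constructor
  · have := Complex.betaIntegral_convergent ha hb
    rw [intervalIntegrable_iff_integrableOn_Ioo_of_le zero_le_one] at this
    exact this
  · rw [← Complex.betaIntegral_eq_Gamma_mul_div _ _ ha hb, Complex.betaIntegral,
      intervalIntegral.integral_of_le zero_le_one, integral_Ioc_eq_integral_Ioo]

theorem image_div_one_add_Ioi : (fun w : ℝ => w / (1 + w)) '' Set.Ioi 0 = Set.Ioo 0 1 := by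
  ext x
  simp only [Set.mem_image, Set.mem_Ioi, Set.mem_Ioo]
  constructor
  · rintro ⟨w, hw, rfl⟩
    exact ⟨by positivity, (div_lt_one (by positivity)).2 (by linarith)⟩
  · rintro ⟨h0, h1⟩
    refine ⟨x / (1 - x), div_pos h0 (by linarith), ?_⟩
    have : 1 - x ≠ 0 := by linarith
    field_simp
    ring

theorem integral_Ioi_beta {a b : ℂ} (ha : 0 < a.re) (hb : 0 < b.re) :
    IntegrableOn (fun w : ℝ => (w : ℂ) ^ (a - 1) * ((1 + w : ℝ) : ℂ) ^ (-(a + b))) (Set.Ioi 0) ∧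
    ∫ w in Set.Ioi (0 : ℝ), (w : ℂ) ^ (a - 1) * ((1 + w : ℝ) : ℂ) ^ (-(a + b)) =
      Complex.Gamma a * Complex.Gamma b / Complex.Gamma (a + b) := by
  have hder : ∀ w ∈ Set.Ioi (0 : ℝ),
      HasDerivWithinAt (fun w : ℝ => w / (1 + w)) (1 / (1 + w) ^ 2) (Set.Ioi 0) w := by
    intro w hw
    have hw' : 1 + w ≠ 0 := by have : 0 < w := hw; positivity
    have := (hasDerivAt_id w).div ((hasDerivAt_id w).const_add 1) hw'
    refine (this.congr_deriv ?_).hasDerivWithinAt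
    simp
  have hinj : InjOn (fun w : ℝ => w / (1 + w)) (Set.Ioi 0) := by
    intro x hx y hy h
    have hx' : 0 < x := hx
    have hy' : 0 < y := hy
    simp only at h
    rw [div_eq_div_iff (by positivity) (by positivity)] at h
    linarith
  have hcongr : ∀ w ∈ Set.Ioi (0 : ℝ), |1 / (1 + w) ^ 2| • (((w / (1 + w) : ℝ) : ℂ) ^ (a - 1) *
      (1 - ((w / (1 + w) : ℝ) : ℂ)) ^ (b - 1)) =
      (w : ℂ) ^ (a - 1) * ((1 + w : ℝ) : ℂ) ^ (-(a + b)) := by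
    intro w hw
    have hw0 : 0 < w := hw
    have h1 : 0 < 1 + w := by positivity
    have h2 : (1 - ((w / (1 + w) : ℝ) : ℂ)) = ((1 / (1 + w) : ℝ) : ℂ) := by
      rw [← ofReal_one, ← ofReal_sub]; congr 1; field_simp; ring
    have h3 : |1 / (1 + w) ^ 2| = Real.exp (-2 * Real.log (1 + w)) := by
      rw [abs_of_pos (by positivity), neg_mul, Real.exp_neg, two_mul, Real.exp_add,
        Real.exp_log h1]
      field_simp
    rw [h2, h3, ofReal_cpow_eq_cexp (by positivity), ofReal_cpow_eq_cexp (by positivity),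
      ofReal_cpow_eq_cexp hw0, ofReal_cpow_eq_cexp h1, Complex.real_smul, ofReal_exp,
      ← Complex.exp_add, ← Complex.exp_add, ← Complex.exp_add,
      Real.log_div hw0.ne' h1.ne', Real.log_div one_ne_zero h1.ne', Real.log_one]
    congr 1
    push_cast
    ring
  obtain ⟨h1, h2⟩ := integral_Ioo_beta ha hb
  rw [← image_div_one_add_Ioi] at h1 h2
  rw [integrableOn_image_iff_integrableOn_abs_deriv_smul measurableSet_Ioi hder hinj] at h1
  rw [integral_image_eq_integral_abs_deriv_smul measurableSet_Ioi hder hinj] at h2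
  exact ⟨h1.congr_fun hcongr measurableSet_Ioi,
    (setIntegral_congr_fun measurableSet_Ioi hcongr).symm.trans h2⟩

/-- Mellin inversion on the imaginary axis. -/
theorem integral_cpow_neg_mul_of_mellin {f : ℝ → ℂ} {M : ℝ → ℂ} {x : ℝ} (hx : 0 < x)
    (hf : IntegrableOn (fun y : ℝ => f y / y) (Set.Ioi 0))
    (hM : ∀ u : ℝ, ∫ y in Set.Ioi (0 : ℝ), (y : ℂ) ^ (I * u - 1) * f y = M u)
    (hMi : Integrable M) (hfx : ContinuousAt f x) :
    ∫ u : ℝ, (x : ℂ) ^ (-(I * u)) * M u = 2 * π * f x := by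
  have hmel : ∀ u : ℝ, mellin f ((0 : ℝ) + u * I) = M u := by
    intro u
    rw [← hM u, mellin]
    simp [mul_comm]
  have hconv : MellinConvergent f ((0 : ℝ) : ℂ) := by
    refine hf.congr_fun (fun y hy => ?_) measurableSet_Ioi
    simp [Complex.cpow_neg_one, div_eq_mul_inv, mul_comm]
  have := mellinInv_mellin_eq 0 f hx hconv (by
    unfold Complex.VerticalIntegrable; simpa only [hmel] using hMi) hfx
  rw [← this, mellinInv]
  simp only [hmel, smul_eq_mul, Complex.real_smul]
  have hpi : (π : ℂ) ≠ 0 := by exact_mod_cast Real.pi_ne_zero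
  push_cast
  simp only [zero_add, mul_comm I]
  rw [← mul_assoc, mul_one_div_cancel (by simp [hpi]), one_mul]

theorem integral_Gamma_vertical_mul_cpow {z : ℂ} (hz : 0 < z.re) {x : ℝ} (hx : 0 < x) :
    ∫ u : ℝ, (x : ℂ) ^ (-(I * u)) * Complex.Gamma (z + I * u) =
      2 * π * ((x : ℂ) ^ z * cexp (-x)) := by
  refine integral_cpow_neg_mul_of_mellin (f := fun y : ℝ => (y : ℂ) ^ z * cexp (-y)) hx ?_ ?_
    (integrable_Gamma_vertical hz) ?_
  · refine (Complex.GammaIntegral_convergent hz).congr_fun (fun y hy => ?_) measurableSet_Ioi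
    have : (y : ℂ) ≠ 0 := by exact_mod_cast (ne_of_gt hy)
    beta_reduce
    rw [Complex.cpow_sub _ _ this, Complex.cpow_one, ofReal_exp, ofReal_neg]
    ring
  · intro u
    rw [Complex.Gamma_eq_integral (by simpa using hz), Complex.GammaIntegral]
    refine setIntegral_congr_fun measurableSet_Ioi (fun y hy => ?_)
    have : (y : ℂ) ≠ 0 := by exact_mod_cast (ne_of_gt hy)
    rw [← mul_assoc, ← Complex.cpow_add _ _ this, ofReal_exp, ofReal_neg, mul_comm]
    congr 2
    ring
  · refine ContinuousAt.mul ?_ (by fun_prop)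
    exact (Complex.continuousAt_ofReal_cpow_const _ _ (.inr hx.ne'))

theorem integrable_Gamma_mul_Gamma_vertical {z D : ℂ} (hz : 0 < z.re) (hD : z.re < D.re) :
    Integrable fun u : ℝ => Complex.Gamma (z + I * u) * Complex.Gamma (D - (z + I * u)) := by
  have hz' : 0 < (D - z).re := by simpa using hD
  refine (integrable_Gamma_vertical hz).mul_bdd (c := Real.Gamma (D - z).re)
    (continuous_Gamma_vertical (z := D - z) (by fun_prop) hz' (by simp)).aestronglyMeasurable
    (.of_forall fun u => ?_)
  have := norm_Gamma_le_Gamma_re (s := D - (z + I * u)) (by simpa using hD)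
  simpa using this

theorem integral_Gamma_mul_Gamma_vertical_mul_cpow {z D : ℂ} (hz : 0 < z.re) (hD : z.re < D.re)
    {x : ℝ} (hx : 0 < x) :
    ∫ u : ℝ, (x : ℂ) ^ (-(I * u)) *
        (Complex.Gamma (z + I * u) * Complex.Gamma (D - (z + I * u))) =
      2 * π * (Complex.Gamma D * ((x : ℂ) ^ z * ((1 + x : ℝ) : ℂ) ^ (-D))) := by
  have hΓ : Complex.Gamma D ≠ 0 := Complex.Gamma_ne_zero_of_re_pos (hz.trans hD)
  refine integral_cpow_neg_mul_of_mellin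
    (f := fun y : ℝ => Complex.Gamma D * ((y : ℂ) ^ z * ((1 + y : ℝ) : ℂ) ^ (-D))) hx ?_ ?_
    (integrable_Gamma_mul_Gamma_vertical hz hD) ?_
  · refine IntegrableOn.congr_fun ((integral_Ioi_beta hz (b := D - z)
      (by simpa using hD)).1.const_mul (Complex.Gamma D)) (fun y hy => ?_) measurableSet_Ioi
    have : (y : ℂ) ≠ 0 := by exact_mod_cast (ne_of_gt hy)
    rw [Complex.cpow_sub _ _ this, Complex.cpow_one]
    simp only [add_sub_cancel]
    ring
  · intro u
    have h := (integral_Ioi_beta (a := z + I * u) (b := D - (z + I * u)) (by simpa using hz)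
      (by simpa using hD)).2
    rw [add_sub_cancel] at h
    rw [← mul_div_cancel₀ (Complex.Gamma (z + I * u) * Complex.Gamma (D - (z + I * u))) hΓ,
      ← h, ← integral_const_mul]
    refine setIntegral_congr_fun measurableSet_Ioi (fun y hy => ?_)
    have : (y : ℂ) ≠ 0 := by exact_mod_cast (ne_of_gt hy)
    rw [show z + I * u - 1 = (I * u - 1) + z by ring, Complex.cpow_add _ _ this]
    ring
  · refine ContinuousAt.mul continuousAt_const (ContinuousAt.mul ?_ ?_)
    · exact (Complex.continuousAt_ofReal_cpow_const _ _ (.inr hx.ne'))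
    · have := Complex.continuousAt_ofReal_cpow_const (1 + x) (-D) (.inr (by positivity))
      exact ContinuousAt.comp (f := fun y : ℝ => 1 + y) (g := fun y : ℝ => (y : ℂ) ^ (-D)) this
        (by fun_prop)

/-- The beta function on vertical lines decays like `|Im s| ^ (-β)`. -/
theorem norm_beta_le_of_one_le_re {s : ℂ} {β : ℝ} (hs : 1 ≤ s.re) (hs' : s.im ≠ 0) (hβ : 0 < β)
    (hβ1 : β ≤ 1) :
    ‖Complex.Gamma s * Complex.Gamma β / Complex.Gamma (s + β)‖ ≤ (π / |s.im|) ^ β / β := by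
  set F : ℝ → ℂ := fun x => (x : ℂ) ^ (s - 1) * (1 - (x : ℂ)) ^ ((β : ℂ) - 1) with hF
  set G : ℝ → ℝ := fun x => ‖F x‖ with hG
  set ρ : ℝ := Real.exp (-(π / |s.im|)) with hρ
  have hu : 0 < |s.im| := abs_pos.2 hs'
  have hρ0 : 0 < ρ := Real.exp_pos _
  have hρ1 : ρ < 1 := Real.exp_lt_one_iff.2 (neg_lt_zero.2 (by positivity))
  have hFi : IntervalIntegrable F volume 0 1 :=
    Complex.betaIntegral_convergent (by linarith) (by simpa using hβ)
  have hFi1 : IntervalIntegrable F volume 0 ρ :=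
    hFi.mono_set (by
      rw [Set.uIcc_of_le hρ0.le, Set.uIcc_of_le zero_le_one]; exact Set.Icc_subset_Icc_right hρ1.le)
  have hFi2 : IntervalIntegrable F volume ρ 1 :=
    hFi.mono_set (by
      rw [Set.uIcc_of_le hρ1.le, Set.uIcc_of_le zero_le_one]; exact Set.Icc_subset_Icc_left hρ0.le)
  have hFi3 : IntervalIntegrable (fun x => ρ • F (ρ * x)) volume 0 1 := by
    have := (hFi1.comp_mul_left (c := ρ))
    simp only [zero_div, div_self hρ0.ne'] at this
    exact this.smul ρ
  have hFval : ∀ x ∈ Set.Ioo (0 : ℝ) 1, G x = x ^ (s.re - 1) * (1 - x) ^ (β - 1) := by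
    intro x hx
    have h1 : (1 - (x : ℂ)) = ((1 - x : ℝ) : ℂ) := by push_cast; ring
    simp only [hG, hF, norm_mul]
    rw [h1, norm_cpow_eq_rpow_re_of_pos hx.1, norm_cpow_eq_rpow_re_of_pos (by linarith [hx.2])]
    simp
  have hρs : ∀ x ∈ Set.Ioo (0 : ℝ) 1, ‖F x + ρ • F (ρ * x)‖ = G x - ρ • G (ρ * x) := by
    intro x hx
    have hx0 := hx.1
    have hρx : ρ * x < 1 := by nlinarith [hx.2]
    have hlt : ρ * x ≤ x := by nlinarith
    have e1 : (1 - (x : ℂ)) = ((1 - x : ℝ) : ℂ) := by push_cast; ring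
    have e2 : (1 - ((ρ * x : ℝ) : ℂ)) = ((1 - ρ * x : ℝ) : ℂ) := by push_cast; ring
    have e3 : (ρ : ℂ) ^ (s - 1) = -((ρ ^ (s.re - 1) : ℝ) : ℂ) := by
      rw [ofReal_cpow_eq_cexp hρ0, Real.rpow_def_of_pos hρ0, ofReal_exp, hρ, Real.log_exp]
      have : (-1 : ℂ) = cexp ((-(π / |s.im|) * s.im : ℝ) * I) := by
        rcases lt_or_gt_of_ne hs' with h | h
        · rw [abs_of_neg h]
          have : -(π / -s.im) * s.im = π := by field_simp
          rw [this, Complex.exp_pi_mul_I]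
        · rw [abs_of_pos h]
          have : -(π / s.im) * s.im = -π := by field_simp
          rw [this, ofReal_neg, neg_mul, Complex.exp_neg, Complex.exp_pi_mul_I]
          norm_num
      rw [← neg_one_mul (cexp _), this, ← Complex.exp_add]
      congr 1
      have hs2 : s - 1 = (s.re - 1) + s.im * I := by
        apply Complex.ext <;> simp
      rw [hs2]
      push_cast
      ring
    have hFρ : ρ • F (ρ * x) = -((x : ℂ) ^ (s - 1) *
        ((ρ * (ρ ^ (s.re - 1)) * (1 - ρ * x) ^ (β - 1) : ℝ) : ℂ)) := by
      simp only [hF]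
      rw [e2, ofReal_mul, Complex.mul_cpow_ofReal_nonneg hρ0.le hx0.le, e3, real_smul,
        ofReal_mul, ofReal_mul, Complex.ofReal_cpow (x := 1 - ρ * x) (by linarith)]
      push_cast
      ring
    have hFx : F x = (x : ℂ) ^ (s - 1) * (((1 - x) ^ (β - 1) : ℝ) : ℂ) := by
      simp only [hF]
      rw [e1, Complex.ofReal_cpow (x := 1 - x) (by linarith [hx.2])]
      push_cast
      ring
    have hGx : G (ρ * x) = ρ ^ (s.re - 1) * x ^ (s.re - 1) * (1 - ρ * x) ^ (β - 1) := by
      rw [hFval _ ⟨by positivity, hρx⟩, Real.mul_rpow hρ0.le hx0.le]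
    rw [hFρ, hFx, ← sub_eq_add_neg, ← mul_sub, norm_mul, ← ofReal_sub, norm_real,
      norm_cpow_eq_rpow_re_of_pos hx0, hGx, hFval x hx, Real.norm_of_nonneg, smul_eq_mul]
    · simp only [sub_re, one_re]; ring
    · rw [sub_nonneg]
      have h1 : ρ * ρ ^ (s.re - 1) ≤ 1 := by
        have := Real.rpow_le_one hρ0.le hρ1.le (sub_nonneg.2 hs)
        nlinarith [Real.rpow_nonneg hρ0.le (s.re - 1)]
      have h2 : (1 - ρ * x) ^ (β - 1) ≤ (1 - x) ^ (β - 1) :=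
        Real.rpow_le_rpow_of_nonpos (by linarith [hx.2]) (by linarith) (by linarith)
      have h3 : 0 ≤ (1 - ρ * x) ^ (β - 1) := Real.rpow_nonneg (by linarith) _
      nlinarith
  have hM : 2 * ∫ x in (0 : ℝ)..1, F x =
      (∫ x in (0 : ℝ)..1, (F x + ρ • F (ρ * x))) + ∫ x in ρ..1, F x := by
    rw [intervalIntegral.integral_add hFi hFi3, intervalIntegral.integral_smul,
      intervalIntegral.smul_integral_comp_mul_left, mul_zero, mul_one, add_assoc,
      intervalIntegral.integral_add_adjacent_intervals hFi1 hFi2]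
    ring
  have hN : (∫ x in (0 : ℝ)..1, (G x - ρ • G (ρ * x))) + ∫ x in ρ..1, G x =
      2 * ∫ x in ρ..1, G x := by
    have h3 : IntervalIntegrable (fun x => ρ • G (ρ * x)) volume 0 1 := by
      have := (hFi1.norm.comp_mul_left (c := ρ))
      simp only [zero_div, div_self hρ0.ne'] at this
      exact this.smul ρ
    rw [intervalIntegral.integral_sub hFi.norm h3, intervalIntegral.integral_smul,
      intervalIntegral.smul_integral_comp_mul_left, mul_zero, mul_one,
      ← intervalIntegral.integral_add_adjacent_intervals hFi1.norm hFi2.norm]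
    ring
  have hle1 : ‖∫ x in (0 : ℝ)..1, (F x + ρ • F (ρ * x))‖ ≤
      ∫ x in (0 : ℝ)..1, (G x - ρ • G (ρ * x)) := by
    refine (intervalIntegral.norm_integral_le_integral_norm zero_le_one).trans_eq ?_
    rw [intervalIntegral.integral_of_le zero_le_one, intervalIntegral.integral_of_le zero_le_one,
      integral_Ioc_eq_integral_Ioo, integral_Ioc_eq_integral_Ioo]
    exact setIntegral_congr_fun measurableSet_Ioo hρs
  have hle2 : ‖∫ x in ρ..1, F x‖ ≤ ∫ x in ρ..1, G x :=
    intervalIntegral.norm_integral_le_integral_norm hρ1.le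
  have hle3 : ∫ x in ρ..1, G x ≤ (1 - ρ) ^ β / β := by
    have hv : ∫ x in ρ..1, (1 - x) ^ (β - 1) = (1 - ρ) ^ β / β := by
      rw [intervalIntegral.integral_comp_sub_left (fun x => x ^ (β - 1)) 1, sub_self,
        integral_rpow (.inl (by linarith))]
      simp [Real.zero_rpow hβ.ne']
    rw [← hv]
    have hi : IntervalIntegrable (fun x : ℝ => (1 - x) ^ (β - 1)) volume ρ 1 := by
      have := (intervalIntegral.intervalIntegrable_rpow' (a := 1 - ρ) (b := 0)
        (r := β - 1) (by linarith)).comp_sub_left 1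
      simpa using this
    refine intervalIntegral.integral_mono_on_of_le_Ioo hρ1.le hFi2.norm hi (fun x hx => ?_)
    have hx0 : 0 < x := hρ0.trans hx.1
    refine (hFval x ⟨hx0, hx.2⟩).trans_le ?_
    refine mul_le_of_le_one_left (Real.rpow_nonneg (by linarith [hx.2]) _)
      (Real.rpow_le_one hx0.le hx.2.le (by linarith))
  have hle4 : (1 - ρ) ^ β ≤ (π / |s.im|) ^ β :=
    Real.rpow_le_rpow (by linarith) (by linarith [Real.add_one_le_exp (-(π / |s.im|))]) hβ.le
  have hB : Complex.Gamma s * Complex.Gamma β / Complex.Gamma (s + β) = ∫ x in (0 : ℝ)..1, F x :=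
    (Complex.betaIntegral_eq_Gamma_mul_div s β (by linarith) (by simpa using hβ)).symm
  rw [hB]
  have h2 : ‖2 * ∫ x in (0 : ℝ)..1, F x‖ ≤ 2 * ∫ x in ρ..1, G x := by
    rw [hM, ← hN]
    exact (norm_add_le _ _).trans (add_le_add hle1 hle2)
  rw [norm_mul, Complex.norm_ofNat] at h2
  have : (1 - ρ) ^ β / β ≤ (π / |s.im|) ^ β / β := by gcongr
  linarith

theorem integrable_Gamma_div_Gamma_vertical {z : ℂ} {c : ℝ} (hz : 0 < z.re) (hc : 1 < c)
    (hc2 : c ≤ 2) :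
    Integrable fun u : ℝ => Complex.Gamma (z + I * u) / Complex.Gamma (z + I * u + c) := by
  have hcont : Continuous fun u : ℝ =>
      Complex.Gamma (z + I * u) / Complex.Gamma (z + I * u + c) := by
    refine (continuous_Gamma_vertical (z := z) (by fun_prop) hz (by simp)).div
      (continuous_Gamma_vertical (z := z + c) (by fun_prop) (by simp; linarith) (by simp)) ?_
    exact fun u => Complex.Gamma_ne_zero_of_re_pos (by simp; linarith)
  have hβ : 0 < c - 1 := by linarith
  have hΓ : 0 < Real.Gamma (c - 1) := Real.Gamma_pos_of_pos hβ
  set K := π ^ (c - 1) / (c - 1) / Real.Gamma (c - 1) with hK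
  have hK0 : 0 ≤ K := by positivity
  have hlarge : ∀ u : ℝ, 1 ≤ |u + z.im| →
      ‖Complex.Gamma (z + I * u) / Complex.Gamma (z + I * u + c)‖ ≤ K * |u + z.im| ^ (-c) := by
    intro u hu
    have hv : 0 < |u + z.im| := by linarith
    set s := z + I * u with hs
    have hsre : s.re = z.re := by simp [hs]
    have hsim : s.im = u + z.im := by simp [hs, add_comm]
    have hs0 : s ≠ 0 := by rintro h; rw [h] at hsre; simp at hsre; linarith
    have h := norm_beta_le_of_one_le_re (s := s + 1) (β := c - 1) (by simp [hsre]; linarith)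
      (by simp [hsim]; exact abs_pos.1 hv) hβ (by linarith)
    have e1 : s + 1 + ((c - 1 : ℝ) : ℂ) = s + c := by push_cast; ring
    have e2 : (s + 1).im = u + z.im := by simp [hsim]
    rw [e1, Complex.Gamma_add_one _ hs0, e2] at h
    have h' : ‖s‖ * (‖Complex.Gamma s / Complex.Gamma (s + c)‖ * Real.Gamma (c - 1)) ≤
        (π / |u + z.im|) ^ (c - 1) / (c - 1) := by
      refine le_trans (le_of_eq ?_) h
      rw [Complex.Gamma_ofReal]
      simp only [norm_mul, norm_div, norm_real, Real.norm_of_nonneg hΓ.le]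
      ring
    have hsn : |u + z.im| ≤ ‖s‖ := by rw [← hsim]; exact Complex.abs_im_le_norm s
    rw [Real.div_rpow pi_pos.le hv.le] at h'
    have h2 : |u + z.im| * (‖Complex.Gamma s / Complex.Gamma (s + c)‖ * Real.Gamma (c - 1)) ≤
        π ^ (c - 1) / |u + z.im| ^ (c - 1) / (c - 1) :=
      (mul_le_mul_of_nonneg_right hsn (by positivity)).trans h'
    have e3 : |u + z.im| ^ (-c) = |u + z.im|⁻¹ * (|u + z.im| ^ (c - 1))⁻¹ := by
      rw [← Real.rpow_neg hv.le, ← Real.rpow_neg_one, ← Real.rpow_add hv]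
      congr 1; ring
    rw [e3, hK]
    have e4 : ‖Complex.Gamma s / Complex.Gamma (s + c)‖ =
        (|u + z.im| * (‖Complex.Gamma s / Complex.Gamma (s + c)‖ * Real.Gamma (c - 1))) *
          (|u + z.im|⁻¹ * (Real.Gamma (c - 1))⁻¹) := by
      field_simp
    rw [e4]
    refine (mul_le_mul_of_nonneg_right h2 (by positivity)).trans_eq ?_
    field_simp
  obtain ⟨K₂, hK₂⟩ := (isCompact_Icc (a := -z.im - 1) (b := -z.im + 1)).exists_bound_of_continuousOn
    hcont.continuousOn
  have hInt : Integrable fun u : ℝ => (2 : ℝ) ^ c * (K + |K₂|) * (1 + ‖u + z.im‖) ^ (-c) := by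
    have := integrable_one_add_norm (E := ℝ) (μ := volume) (r := c) (by simpa using hc)
    exact (this.comp_add_right z.im).const_mul _
  refine hInt.mono' hcont.aestronglyMeasurable (.of_forall fun u => ?_)
  rw [Real.norm_eq_abs (u + z.im)]
  have h1 : ‖Complex.Gamma (z + I * u) / Complex.Gamma (z + I * u + c)‖ ≤
      (K + |K₂|) * (max 1 |u + z.im|) ^ (-c) := by
    rcases le_total 1 |u + z.im| with h | h
    · rw [max_eq_right h]
      refine (hlarge u h).trans ?_
      gcongr
      linarith [abs_nonneg K₂]
    · rw [max_eq_left h, Real.one_rpow, mul_one]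
      have := hK₂ u (by
        rw [abs_le] at h
        constructor <;> linarith)
      linarith [le_abs_self K₂]
  refine h1.trans ?_
  rw [mul_comm ((2 : ℝ) ^ c), mul_assoc]
  refine mul_le_mul_of_nonneg_left ?_ (by positivity)
  have h2 : 0 < max 1 |u + z.im| := by positivity
  rw [Real.rpow_neg h2.le, Real.rpow_neg (by positivity), ← div_eq_mul_inv,
    ← Real.div_rpow (by norm_num) (by positivity), ← Real.inv_rpow h2.le]
  refine Real.rpow_le_rpow (by positivity) ?_ (by linarith)
  rw [inv_le_comm₀ h2 (by positivity), inv_div, div_le_iff₀ (by norm_num)]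
  have := le_max_left 1 |u + z.im|
  have := le_max_right 1 |u + z.im|
  linarith

theorem integral_Gamma_div_Gamma_vertical_mul_cpow {z : ℂ} {c : ℝ} (hz : 0 < z.re) (hc : 1 < c)
    (hc2 : c ≤ 2) {x : ℝ} (hx : 0 < x) (hx1 : x < 1) :
    ∫ u : ℝ, (x : ℂ) ^ (-(I * u)) *
        (Complex.Gamma (z + I * u) / Complex.Gamma (z + I * u + c)) =
      2 * π * ((x : ℂ) ^ z * (1 - (x : ℂ)) ^ ((c : ℂ) - 1) / Complex.Gamma c) := by
  have hc0 : 0 < (c : ℂ).re := by simp; linarith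
  have hΓ : Complex.Gamma c ≠ 0 := Complex.Gamma_ne_zero_of_re_pos hc0
  set g : ℝ → ℂ := fun y => (y : ℂ) ^ z * (1 - (y : ℂ)) ^ ((c : ℂ) - 1) / Complex.Gamma c with hg
  have hrestr : ∀ h : ℝ → ℂ, (fun y => h y * (Set.Ioo (0 : ℝ) 1).indicator g y) =
      (Set.Ioo (0 : ℝ) 1).indicator (fun y => h y * g y) := by
    intro h
    ext y
    by_cases hy : y ∈ Set.Ioo (0 : ℝ) 1 <;> simp [hy]
  have hsub : Set.Ioi (0 : ℝ) ∩ Set.Ioo 0 1 = Set.Ioo 0 1 :=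
    Set.inter_eq_right.2 Set.Ioo_subset_Ioi_self
  have hmem : Set.Ioo (0 : ℝ) 1 ∈ nhds x := Ioo_mem_nhds hx hx1
  have hev : (Set.Ioo (0 : ℝ) 1).indicator g =ᶠ[nhds x] g :=
    Filter.eventually_of_mem hmem fun y hy => Set.indicator_of_mem hy _
  have hgx : (Set.Ioo (0 : ℝ) 1).indicator g x = g x := Set.indicator_of_mem (a := x) (s := Set.Ioo 0 1) ⟨hx, hx1⟩ g
  have := integral_cpow_neg_mul_of_mellin (f := (Set.Ioo (0 : ℝ) 1).indicator g) hx ?_ ?_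
    (integrable_Gamma_div_Gamma_vertical hz hc hc2) ?_
  · rw [this, hgx]
  · have h1 := hrestr (fun y => (y : ℂ)⁻¹)
    simp only [div_eq_inv_mul]
    rw [h1, IntegrableOn, integrable_indicator_iff measurableSet_Ioo, IntegrableOn,
      Measure.restrict_restrict measurableSet_Ioo, Set.inter_comm, hsub]
    refine IntegrableOn.congr_fun ((integral_Ioo_beta hz hc0).1.div_const (Complex.Gamma c))
      (fun y hy => ?_) measurableSet_Ioo
    have : (y : ℂ) ≠ 0 := by exact_mod_cast (ne_of_gt hy.1)
    simp only [hg]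
    rw [Complex.cpow_sub _ _ this, Complex.cpow_one]
    ring
  · intro u
    rw [hrestr, setIntegral_indicator measurableSet_Ioo, hsub]
    have h := (integral_Ioo_beta (a := z + I * u) (b := c) (by simpa using hz) hc0).2
    rw [← mul_div_cancel_right₀ (Complex.Gamma (z + I * u) / Complex.Gamma (z + I * u + c)) hΓ,
      div_mul_eq_mul_div, ← h, ← integral_div]
    refine setIntegral_congr_fun measurableSet_Ioo (fun y hy => ?_)
    have : (y : ℂ) ≠ 0 := by exact_mod_cast (ne_of_gt hy.1)
    simp only [hg]
    rw [show z + I * u - 1 = (I * u - 1) + z by ring, Complex.cpow_add _ _ this]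
    ring
  · refine ContinuousAt.congr ?_ hev.symm
    refine ContinuousAt.div_const (ContinuousAt.mul ?_ ?_) _
    · exact (Complex.continuousAt_ofReal_cpow_const _ _ (.inr hx.ne'))
    · refine ContinuousAt.cpow (by fun_prop) continuousAt_const (.inl ?_)
      simp
      linarith

theorem integrable_prod_mul_unimodular {α β : Type*} [MeasurableSpace α] [MeasurableSpace β]
    {μ : Measure α} {ν : Measure β} [SFinite μ] [SFinite ν] {f : α → ℂ} {g : β → ℂ} {h : α × β → ℂ}
    (hf : Integrable f μ) (hg : Integrable g ν) (hm : Measurable h) (hh : ∀ p, ‖h p‖ ≤ 1) :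
    Integrable (fun p : α × β => f p.1 * g p.2 * h p) (μ.prod ν) :=
  (hf.mul_prod hg).mul_bdd (c := 1) hm.aestronglyMeasurable (.of_forall hh)

theorem MellinBarnes_term {δ c : ℝ} {D q B p₁ A p₂ : ℂ} (hδ : 0 < δ) (hc : 1 < c) (hc2 : c ≤ 2)
    (hD : δ < D.re) (hq : δ < q.re) (hB : 2 * δ < B.re) (hp₁ : 0 < p₁.re) (hA : 3 * δ < A.re)
    (hp₂ : 0 < p₂.re) {T : ℝ × ℝ × ℝ → ℂ} (hT : ∀ u, T u =
      Complex.Gamma (δ + I * u.1) / Complex.Gamma (δ + I * u.1 + c) *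
      ((Complex.Gamma (δ + I * u.2.1) * Complex.Gamma (D - (δ + I * u.2.1))) *
        (Complex.Gamma (δ + I * u.2.2) * Complex.Gamma (q - (δ + I * u.2.2)))) *
      (Complex.Gamma (B - (δ + I * u.1) - (δ + I * u.2.1)) /
        Complex.Gamma (B - (δ + I * u.1) - (δ + I * u.2.1) + p₁) *
      (Complex.Gamma (A - (δ + I * u.1) - (δ + I * u.2.1) - (δ + I * u.2.2)) /
        Complex.Gamma (A - (δ + I * u.1) - (δ + I * u.2.1) - (δ + I * u.2.2) + p₂)))) :
    Integrable T ∧ ∫ u, T u = (2 * π) ^ 3 * (Complex.Gamma D * Complex.Gamma q /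
      (Complex.Gamma c * (Complex.Gamma p₁ * Complex.Gamma p₂))) *
      ∫ p in Set.Ioo (0 : ℝ) 1 ×ˢ Set.Ioo (0 : ℝ) 1,
        (p.1 : ℂ) ^ (B - 1) * (1 - (p.1 : ℂ)) ^ (p₁ - 1) *
        ((p.2 : ℂ) ^ (A - 1) * (1 - (p.2 : ℂ)) ^ (p₂ - 1)) *
        ((1 - ((p.1 * p.2 : ℝ) : ℂ)) ^ ((c : ℂ) - 1) * ((1 + p.1 * p.2 : ℝ) : ℂ) ^ (-D) *
          ((1 + p.2 : ℝ) : ℂ) ^ (-q)) := by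
  have hδ' : 0 < (δ : ℂ).re := by simpa using hδ
  have hΓ₁ := Complex.Gamma_ne_zero_of_re_pos hp₁
  have hΓ₂ := Complex.Gamma_ne_zero_of_re_pos hp₂
  set Φ : ℝ × ℝ × ℝ → ℂ := fun u =>
      Complex.Gamma (δ + I * u.1) / Complex.Gamma (δ + I * u.1 + c) *
      ((Complex.Gamma (δ + I * u.2.1) * Complex.Gamma (D - (δ + I * u.2.1))) *
        (Complex.Gamma (δ + I * u.2.2) * Complex.Gamma (q - (δ + I * u.2.2)))) with hΦdef
  have hΦ : Integrable Φ :=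
    (integrable_Gamma_div_Gamma_vertical hδ' hc hc2).mul_prod
      ((integrable_Gamma_mul_Gamma_vertical hδ' (by simpa using hD)).mul_prod
        (integrable_Gamma_mul_Gamma_vertical hδ' (by simpa using hq)))
  set X : ℝ → ℂ := fun x => (x : ℂ) ^ (B - 2 * δ - 1) * (1 - (x : ℂ)) ^ (p₁ - 1) with hX
  set Y : ℝ → ℂ := fun y => (y : ℂ) ^ (A - 3 * δ - 1) * (1 - (y : ℂ)) ^ (p₂ - 1) with hY
  have hXi : IntegrableOn X (Set.Ioo 0 1) := (integral_Ioo_beta (by simpa using hB) hp₁).1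
  have hYi : IntegrableOn Y (Set.Ioo 0 1) := (integral_Ioo_beta (by simpa using hA) hp₂).1
  set E : (ℝ × ℝ × ℝ) × (ℝ × ℝ) → ℂ := fun w =>
    cexp (((-((w.1.1 + w.1.2.1) * Real.log w.2.1 +
      (w.1.1 + w.1.2.1 + w.1.2.2) * Real.log w.2.2) : ℝ) : ℂ) * I) with hE
  have hEm : Measurable E := by fun_prop
  have hEx : ∀ u : ℝ × ℝ × ℝ, ∀ p ∈ Set.Ioo (0 : ℝ) 1 ×ˢ Set.Ioo (0 : ℝ) 1, E (u, p) =
      (p.1 : ℂ) ^ (-(I * (u.1 + u.2.1))) * (p.2 : ℂ) ^ (-(I * (u.1 + u.2.1 + u.2.2))) := by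
    intro u p hp
    simp only [hE]
    rw [ofReal_cpow_eq_cexp hp.1.1, ofReal_cpow_eq_cexp hp.2.1, ← Complex.exp_add]
    congr 1
    push_cast
    ring
  have hXY : IntegrableOn (fun p : ℝ × ℝ => X p.1 * Y p.2)
      (Set.Ioo (0 : ℝ) 1 ×ˢ Set.Ioo (0 : ℝ) 1) := by
    rw [IntegrableOn, Measure.volume_eq_prod, ← Measure.prod_restrict]
    exact hXi.mul_prod hYi
  have hG := integrable_prod_mul_unimodular hΦ hXY hEm
      fun w => (Complex.norm_exp_ofReal_mul_I _).le
  have hms : MeasurableSet (Set.Ioo (0 : ℝ) 1 ×ˢ Set.Ioo (0 : ℝ) 1) :=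
    measurableSet_Ioo.prod measurableSet_Ioo
  have hTG : ∀ u, T u = (Complex.Gamma p₁ * Complex.Gamma p₂)⁻¹ *
      ∫ p in Set.Ioo (0 : ℝ) 1 ×ˢ Set.Ioo (0 : ℝ) 1, Φ u * (X p.1 * Y p.2) * E (u, p) := by
    intro u
    have h1 := (integral_Ioo_beta (a := B - (δ + I * u.1) - (δ + I * u.2.1)) (b := p₁)
      (by simp; linarith) hp₁).2
    have h2 := (integral_Ioo_beta (a := A - (δ + I * u.1) - (δ + I * u.2.1) - (δ + I * u.2.2))
      (b := p₂) (by simp; linarith) hp₂).2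
    have h3 : ∫ p in Set.Ioo (0 : ℝ) 1 ×ˢ Set.Ioo (0 : ℝ) 1, Φ u * (X p.1 * Y p.2) * E (u, p) =
        Φ u * ∫ p in Set.Ioo (0 : ℝ) 1 ×ˢ Set.Ioo (0 : ℝ) 1,
          ((p.1 : ℂ) ^ (B - (δ + I * u.1) - (δ + I * u.2.1) - 1) * (1 - (p.1 : ℂ)) ^ (p₁ - 1)) *
          ((p.2 : ℂ) ^ (A - (δ + I * u.1) - (δ + I * u.2.1) - (δ + I * u.2.2) - 1) *
            (1 - (p.2 : ℂ)) ^ (p₂ - 1)) := by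
      rw [← integral_const_mul]
      refine setIntegral_congr_fun hms fun p hp => ?_
      have n1 : (p.1 : ℂ) ≠ 0 := by exact_mod_cast (ne_of_gt hp.1.1)
      have n2 : (p.2 : ℂ) ≠ 0 := by exact_mod_cast (ne_of_gt hp.2.1)
      simp only [hEx u p hp, hX, hY]
      rw [show B - (δ + I * u.1) - (δ + I * u.2.1) - 1 =
          (B - 2 * δ - 1) + -(I * (u.1 + u.2.1)) by ring, Complex.cpow_add _ _ n1,
        show A - (δ + I * u.1) - (δ + I * u.2.1) - (δ + I * u.2.2) - 1 =
          (A - 3 * δ - 1) + -(I * (u.1 + u.2.1 + u.2.2)) by ring, Complex.cpow_add _ _ n2]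
      ring
    rw [h3, Measure.volume_eq_prod, setIntegral_prod_mul (fun x : ℝ =>
      (x : ℂ) ^ (B - (δ + I * u.1) - (δ + I * u.2.1) - 1) * (1 - (x : ℂ)) ^ (p₁ - 1))
      (fun y : ℝ => (y : ℂ) ^ (A - (δ + I * u.1) - (δ + I * u.2.1) - (δ + I * u.2.2) - 1) *
            (1 - (y : ℂ)) ^ (p₂ - 1)), h1, h2, hT]
    have halg : ∀ F a b e f k l : ℂ, k ≠ 0 → l ≠ 0 →
        F * (a / b * (e / f)) = (k * l)⁻¹ * (F * ((a * k / b) * (e * l / f))) := by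
      intro F a b e f k l hk hl
      rw [show (k * l)⁻¹ * (F * ((a * k / b) * (e * l / f))) =
        F * (a / b * (e / f)) * (k / k) * (l / l) by ring, div_self hk, div_self hl,
        mul_one, mul_one]
    exact halg _ _ _ _ _ _ _ hΓ₁ hΓ₂
  have hTfun : T = fun u => (Complex.Gamma p₁ * Complex.Gamma p₂)⁻¹ *
      ∫ p in Set.Ioo (0 : ℝ) 1 ×ˢ Set.Ioo (0 : ℝ) 1, Φ u * (X p.1 * Y p.2) * E (u, p) :=
    funext hTG
  refine ⟨?_, ?_⟩
  · rw [hTfun]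
    exact hG.integral_prod_left.const_mul _
  · rw [hTfun, integral_const_mul, integral_integral_swap hG,
      ← integral_const_mul, ← integral_const_mul]
    refine setIntegral_congr_fun hms fun p hp => ?_
    have px : 0 < p.1 := hp.1.1
    have py : 0 < p.2 := hp.2.1
    have pxy : 0 < p.1 * p.2 := mul_pos px py
    have pxy1 : p.1 * p.2 < 1 := mul_lt_one_of_nonneg_of_lt_one_left px.le hp.1.2 hp.2.2.le
    have n1 : (p.1 : ℂ) ≠ 0 := by exact_mod_cast px.ne'
    have n2 : (p.2 : ℂ) ≠ 0 := by exact_mod_cast py.ne'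
    have e1 := integral_Gamma_div_Gamma_vertical_mul_cpow hδ' hc hc2 pxy pxy1
    have e2 := integral_Gamma_mul_Gamma_vertical_mul_cpow (D := D) hδ' (by simpa using hD) pxy
    have e3 := integral_Gamma_mul_Gamma_vertical_mul_cpow (D := q) hδ' (by simpa using hq) py
    have e4 : ∫ u, Φ u * (X p.1 * Y p.2) * E (u, p) = X p.1 * Y p.2 *
        ∫ u : ℝ × ℝ × ℝ, (((p.1 * p.2 : ℝ) : ℂ) ^ (-(I * u.1)) *
          (Complex.Gamma (δ + I * u.1) / Complex.Gamma (δ + I * u.1 + c))) *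
          ((fun v : ℝ × ℝ => (((p.1 * p.2 : ℝ) : ℂ) ^ (-(I * v.1)) *
            (Complex.Gamma (δ + I * v.1) * Complex.Gamma (D - (δ + I * v.1)))) *
          ((p.2 : ℂ) ^ (-(I * v.2)) *
            (Complex.Gamma (δ + I * v.2) * Complex.Gamma (q - (δ + I * v.2))))) u.2) := by
      rw [← integral_const_mul]
      congr 1 with u
      rw [hEx u p hp]
      simp only [hΦdef]
      rw [ofReal_mul, Complex.mul_cpow_ofReal_nonneg px.le py.le,
        Complex.mul_cpow_ofReal_nonneg px.le py.le, mul_add, neg_add, Complex.cpow_add _ _ n1,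
        mul_add, mul_add, neg_add, neg_add, Complex.cpow_add _ _ n2, Complex.cpow_add _ _ n2]
      ring
    simp only [e4]
    rw [Measure.volume_eq_prod, integral_prod_mul (fun a : ℝ => ((p.1 * p.2 : ℝ) : ℂ) ^ (-(I * a)) *
          (Complex.Gamma (δ + I * a) / Complex.Gamma (δ + I * a + c)))
          (fun v : ℝ × ℝ => (((p.1 * p.2 : ℝ) : ℂ) ^ (-(I * v.1)) *
            (Complex.Gamma (δ + I * v.1) * Complex.Gamma (D - (δ + I * v.1)))) *
          ((p.2 : ℂ) ^ (-(I * v.2)) *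
            (Complex.Gamma (δ + I * v.2) * Complex.Gamma (q - (δ + I * v.2))))),
      Measure.volume_eq_prod, integral_prod_mul
        (fun a : ℝ => (((p.1 * p.2 : ℝ) : ℂ) ^ (-(I * a)) *
            (Complex.Gamma (δ + I * a) * Complex.Gamma (D - (δ + I * a)))))
          (fun b : ℝ => ((p.2 : ℂ) ^ (-(I * b)) *
            (Complex.Gamma (δ + I * b) * Complex.Gamma (q - (δ + I * b))))), e1, e2, e3]
    simp only [hX, hY]
    rw [ofReal_mul, Complex.mul_cpow_ofReal_nonneg px.le py.le]
    rw [show B - 1 = (B - 2 * δ - 1) + (δ + δ) by ring, Complex.cpow_add (B - 2 * δ - 1) _ n1,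
      show A - 1 = (A - 3 * δ - 1) + (δ + δ + δ) by ring, Complex.cpow_add (A - 3 * δ - 1) _ n2,
      Complex.cpow_add _ _ n1, Complex.cpow_add _ _ n2, Complex.cpow_add _ _ n2]
    ring

section ChangeOfVariables

variable {s : Set (ℝ × ℝ)} {f g fa fz ga gz : ℝ × ℝ → ℝ}

theorem det_smul_fst_add_smul_snd (a b c d : ℝ) :
    ((a • ContinuousLinearMap.fst ℝ ℝ ℝ + b • ContinuousLinearMap.snd ℝ ℝ ℝ).prod
      (c • ContinuousLinearMap.fst ℝ ℝ ℝ + d • ContinuousLinearMap.snd ℝ ℝ ℝ)).det =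
      a * d - b * c := by
  have : ((a • ContinuousLinearMap.fst ℝ ℝ ℝ + b • ContinuousLinearMap.snd ℝ ℝ ℝ).prod
      (c • ContinuousLinearMap.fst ℝ ℝ ℝ + d • ContinuousLinearMap.snd ℝ ℝ ℝ)) =
      LinearMap.toContinuousLinearMap (Matrix.toLin (Module.Basis.finTwoProd ℝ)
        (Module.Basis.finTwoProd ℝ) !![a, b; c, d]) := by
    ext <;> simp [Matrix.toLin_finTwoProd_apply]
  rw [this, LinearMap.det_toContinuousLinearMap, LinearMap.det_toLin, Matrix.det_fin_two_of]

/-- `f` is differentiable at `p` with partial derivatives `a` and `b`. -/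
def HasPartialsAt (f : ℝ × ℝ → ℝ) (a b : ℝ) (p : ℝ × ℝ) : Prop :=
  HasFDerivAt f (a • ContinuousLinearMap.fst ℝ ℝ ℝ + b • ContinuousLinearMap.snd ℝ ℝ ℝ) p

namespace HasPartialsAt

variable {u v : ℝ × ℝ → ℝ} {a b a' b' : ℝ} {p : ℝ × ℝ}

theorem congr_partials (h : HasPartialsAt u a b p) (ha : a = a') (hb : b = b') :
    HasPartialsAt u a' b' p := by
  rwa [← ha, ← hb]

theorem const (k : ℝ) : HasPartialsAt (fun _ => k) 0 0 p := by
  simpa [HasPartialsAt] using hasFDerivAt_const k p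

theorem fst : HasPartialsAt (fun q => q.1) 1 0 p := by
  simpa [HasPartialsAt] using hasFDerivAt_fst

theorem snd : HasPartialsAt (fun q => q.2) 0 1 p := by
  simpa [HasPartialsAt] using hasFDerivAt_snd

theorem add (hu : HasPartialsAt u a b p) (hv : HasPartialsAt v a' b' p) :
    HasPartialsAt (fun q => u q + v q) (a + a') (b + b') p := by
  refine (HasFDerivAt.fun_add hu hv).congr_fderiv ?_
  ext <;> simp

theorem mul (hu : HasPartialsAt u a b p) (hv : HasPartialsAt v a' b' p) :
    HasPartialsAt (fun q => u q * v q) (u p * a' + v p * a) (u p * b' + v p * b) p := by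
  refine (HasFDerivAt.fun_mul hu hv).congr_fderiv ?_
  ext <;> simp

theorem inv (hv : HasPartialsAt v a b p) (h0 : v p ≠ 0) :
    HasPartialsAt (fun q => (v q)⁻¹) (-(v p ^ 2)⁻¹ * a) (-(v p ^ 2)⁻¹ * b) p := by
  refine ((hasDerivAt_inv h0).comp_hasFDerivAt p hv).congr_fderiv ?_
  ext <;> simp

theorem div (hu : HasPartialsAt u a b p) (hv : HasPartialsAt v a' b' p) (h0 : v p ≠ 0) :
    HasPartialsAt (fun q => u q / v q) ((a * v p - u p * a') / v p ^ 2)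
      ((b * v p - u p * b') / v p ^ 2) p := by
  simp only [div_eq_mul_inv]
  refine (hu.mul (hv.inv h0)).congr_partials ?_ ?_ <;> field_simp <;> ring

end HasPartialsAt

theorem integral_image_prodMk (hs : MeasurableSet s)
    (hf : ∀ p ∈ s, HasPartialsAt f (fa p) (fz p) p)
    (hg : ∀ p ∈ s, HasPartialsAt g (ga p) (gz p) p)
    (hinj : Set.InjOn (fun p => (f p, g p)) s) (F : ℝ × ℝ → ℂ) :
    ∫ p in (fun p => (f p, g p)) '' s, F p =
      ∫ p in s, ((|fa p * gz p - fz p * ga p| : ℝ) : ℂ) * F (f p, g p) := by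
  rw [integral_image_eq_integral_abs_det_fderiv_smul volume hs
    (fun p hp => ((hf p hp).prodMk (hg p hp)).hasFDerivWithinAt) hinj]
  simp only [det_smul_fst_add_smul_snd, Complex.real_smul]

theorem integrableOn_image_prodMk_iff (hs : MeasurableSet s)
    (hf : ∀ p ∈ s, HasPartialsAt f (fa p) (fz p) p)
    (hg : ∀ p ∈ s, HasPartialsAt g (ga p) (gz p) p)
    (hinj : Set.InjOn (fun p => (f p, g p)) s) (F : ℝ × ℝ → ℂ) :
    IntegrableOn F ((fun p => (f p, g p)) '' s) ↔
      IntegrableOn (fun p => ((|fa p * gz p - fz p * ga p| : ℝ) : ℂ) * F (f p, g p)) s := by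
  rw [integrableOn_image_iff_integrableOn_abs_det_fderiv_smul volume hs
    (fun p hp => ((hf p hp).prodMk (hg p hp)).hasFDerivWithinAt) hinj]
  simp only [det_smul_fst_add_smul_snd, Complex.real_smul]

end ChangeOfVariables

theorem image_unitSquare :
    (fun p : ℝ × ℝ => (p.1 * (2 + (1 + p.1) * p.2) / (2 * p.1 + (1 + p.1) * p.2),
      (2 * p.1 + (1 + p.1) * p.2) / (2 + (1 + p.1) * p.2))) ''
      (Set.Ioo (0 : ℝ) 1 ×ˢ Set.Ioi (0 : ℝ)) = Set.Ioo (0 : ℝ) 1 ×ˢ Set.Ioo (0 : ℝ) 1 := by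
  ext ⟨x, y⟩
  simp only [Set.mem_image, Set.mem_prod, Set.mem_Ioo, Set.mem_Ioi, Prod.mk.injEq, Prod.exists]
  constructor
  · rintro ⟨a, z, ⟨⟨ha0, ha1⟩, hz⟩, rfl, rfl⟩
    have h1 : 0 < (1 + a) * z := by positivity
    refine ⟨⟨by positivity, ?_⟩, by positivity, ?_⟩
    · rw [div_lt_one (by positivity)]; nlinarith
    · rw [div_lt_one (by positivity)]; linarith
  · rintro ⟨⟨hx0, hx1⟩, hy0, hy1⟩
    have hxy : x * y < y := by nlinarith
    have h1 : 0 < 1 - y := by linarith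
    have h2 : 0 < y - x * y := by linarith
    have h3 : 0 < 1 + x * y := by positivity
    have h4 : 0 < 1 - x * y := by linarith
    refine ⟨x * y, 2 * (y - x * y) / ((1 + x * y) * (1 - y)),
      ⟨⟨by positivity, by linarith⟩, by positivity⟩, ?_⟩
    have e1 : (1 + x * y) * (2 * (y - x * y) / ((1 + x * y) * (1 - y))) =
        2 * (y - x * y) / (1 - y) := by field_simp
    have e2 : 2 * (x * y) + 2 * (y - x * y) / (1 - y) = 2 * y * (1 - x * y) / (1 - y) := by
      field_simp; ring
    have e3 : 2 + 2 * (y - x * y) / (1 - y) = 2 * (1 - x * y) / (1 - y) := by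
      field_simp; ring
    rw [e1, e2, e3]
    constructor <;> field_simp
    exact div_self (by linarith)

theorem injOn_unitSquare :
    Set.InjOn (fun p : ℝ × ℝ => (p.1 * (2 + (1 + p.1) * p.2) / (2 * p.1 + (1 + p.1) * p.2),
      (2 * p.1 + (1 + p.1) * p.2) / (2 + (1 + p.1) * p.2)))
      (Set.Ioo (0 : ℝ) 1 ×ˢ Set.Ioi (0 : ℝ)) := by
  rintro ⟨a, z⟩ ⟨⟨ha0, ha1⟩, hz⟩ ⟨b, w⟩ ⟨⟨hb0, hb1⟩, hw⟩ h
  rw [Set.mem_Ioi] at hz hw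
  simp only [Prod.mk.injEq] at h
  obtain ⟨h1, h2⟩ := h
  have hab : a = b := by
    have e := congrArg₂ (· * ·) h1 h2
    have e1 : ∀ a z : ℝ, 0 < a → 0 < z → a * (2 + (1 + a) * z) / (2 * a + (1 + a) * z) *
        ((2 * a + (1 + a) * z) / (2 + (1 + a) * z)) = a := by
      intro a z ha hz
      field_simp
    rwa [e1 a z ha0 hz, e1 b w hb0 hw] at e
  subst hab
  rw [div_eq_div_iff (by positivity) (by positivity)] at h2
  have : (1 + a) * (1 - a) * (z - w) = 0 := by linear_combination h2 / 2
  have h3 : (1 + a) * (1 - a) ≠ 0 := by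
    have : 0 < 1 - a := by linarith
    positivity
  have := (mul_eq_zero.1 this).resolve_left h3
  rw [sub_eq_zero.1 this]

theorem integral_unitSquare {B p₁ p₂ D q c : ℂ} (hq : q = p₁ + p₂) (hc : c = 2 - q) :
    ∫ p in Set.Ioo (0 : ℝ) 1 ×ˢ Set.Ioo (0 : ℝ) 1,
        (p.1 : ℂ) ^ (B - 1) * (1 - (p.1 : ℂ)) ^ (p₁ - 1) *
        ((p.2 : ℂ) ^ (B + p₁ - 1) * (1 - (p.2 : ℂ)) ^ (p₂ - 1)) *
        ((1 - ((p.1 * p.2 : ℝ) : ℂ)) ^ (c - 1) * ((1 + p.1 * p.2 : ℝ) : ℂ) ^ (-D) *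
          ((1 + p.2 : ℝ) : ℂ) ^ (-q)) =
      2 ^ (-p₁) * ((∫ a in Set.Ioo (0 : ℝ) 1, (a : ℂ) ^ (B - 1) * ((1 + a : ℝ) : ℂ) ^ (-(D + p₂))) *
        ∫ z in Set.Ioi (0 : ℝ), (z : ℂ) ^ (p₁ - 1) * ((1 + z : ℝ) : ℂ) ^ (-(p₁ + p₂))) := by
  have hms : MeasurableSet (Set.Ioo (0 : ℝ) 1 ×ˢ Set.Ioi (0 : ℝ)) :=
    measurableSet_Ioo.prod measurableSet_Ioi
  rw [← image_unitSquare, integral_image_prodMk (fa := fun p =>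
      ((2 + (1 + p.1) * p.2 + p.1 * p.2) * (2 * p.1 + (1 + p.1) * p.2) -
        p.1 * (2 + (1 + p.1) * p.2) * (2 + p.2)) / (2 * p.1 + (1 + p.1) * p.2) ^ 2)
      (fz := fun p => (p.1 * (1 + p.1) * (2 * p.1 - 2)) / (2 * p.1 + (1 + p.1) * p.2) ^ 2)
      (ga := fun p => ((2 + p.2) * (2 + (1 + p.1) * p.2) - (2 * p.1 + (1 + p.1) * p.2) * p.2) /
        (2 + (1 + p.1) * p.2) ^ 2)
      (gz := fun p => ((1 + p.1) * (2 - 2 * p.1)) / (2 + (1 + p.1) * p.2) ^ 2)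
      hms ?_ ?_ injOn_unitSquare, ← setIntegral_prod_mul, ← integral_const_mul,
      ← Measure.volume_eq_prod]
  · refine setIntegral_congr_fun hms fun ⟨a, z⟩ hp => ?_
    obtain ⟨⟨ha0, ha1⟩, hz⟩ := hp
    simp only [Set.mem_Ioi] at ha0 ha1 hz
    have hL₁ : 0 < 2 * a + (1 + a) * z := by positivity
    have hL₂ : 0 < 2 + (1 + a) * z := by positivity
    have ha : 0 < 1 - a := by linarith
    have ha' : 0 < 1 + a := by linarith
    have hz' : 0 < 1 + z := by linarith
    simp only
    have j : |((2 + (1 + a) * z + a * z) * (2 * a + (1 + a) * z) -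
        a * (2 + (1 + a) * z) * (2 + z)) / (2 * a + (1 + a) * z) ^ 2 *
        (((1 + a) * (2 - 2 * a)) / (2 + (1 + a) * z) ^ 2) -
        (a * (1 + a) * (2 * a - 2)) / (2 * a + (1 + a) * z) ^ 2 *
        (((2 + z) * (2 + (1 + a) * z) - (2 * a + (1 + a) * z) * z) /
        (2 + (1 + a) * z) ^ 2)| =
        2 * ((1 - a) * (1 + a)) / ((2 * a + (1 + a) * z) * (2 + (1 + a) * z)) := by
      rw [← abs_of_pos (a := 2 * ((1 - a) * (1 + a)) /
        ((2 * a + (1 + a) * z) * (2 + (1 + a) * z))) (by positivity)]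
      congr 1
      field_simp
      ring
    rw [j]
    set L₁ := 2 * a + (1 + a) * z with hL₁d
    set L₂ := 2 + (1 + a) * z with hL₂d
    have x1 : (1 : ℂ) - ((a * L₂ / L₁ : ℝ) : ℂ) = (((1 - a) * (1 + a) * z / L₁ : ℝ) : ℂ) := by
      rw [← ofReal_one, ← ofReal_sub]
      congr 1
      field_simp
      rw [hL₁d, hL₂d]
      ring
    have y1 : (1 : ℂ) - ((L₁ / L₂ : ℝ) : ℂ) = ((2 * (1 - a) / L₂ : ℝ) : ℂ) := by
      rw [← ofReal_one, ← ofReal_sub]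
      congr 1
      field_simp
      rw [hL₁d, hL₂d]
      ring
    have y2 : (1 + L₁ / L₂ : ℝ) = 2 * ((1 + a) * (1 + z)) / L₂ := by
      field_simp
      rw [hL₁d, hL₂d]
      ring
    have xy : a * L₂ / L₁ * (L₁ / L₂) = a := by field_simp
    have xy1 : (1 : ℂ) - (a : ℂ) = ((1 - a : ℝ) : ℂ) := by push_cast; rfl
    have two : (2 : ℂ) = ((2 : ℝ) : ℂ) := by norm_num
    have jac : ((2 * ((1 - a) * (1 + a)) / (L₁ * L₂) : ℝ) : ℂ) =
        cexp (Real.log (2 * ((1 - a) * (1 + a)) / (L₁ * L₂))) := by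
      rw [← ofReal_exp, Real.exp_log (by positivity)]
    rw [jac, x1, y1, y2, xy, xy1]
    conv_rhs => rw [two]
    rw [ofReal_cpow_eq_cexp (x := a * L₂ / L₁) (by positivity),
      ofReal_cpow_eq_cexp (x := (1 - a) * (1 + a) * z / L₁) (by positivity),
      ofReal_cpow_eq_cexp (x := L₁ / L₂) (by positivity),
      ofReal_cpow_eq_cexp (x := 2 * (1 - a) / L₂) (by positivity),
      ofReal_cpow_eq_cexp (x := 2 * ((1 + a) * (1 + z)) / L₂) (by positivity),
      ofReal_cpow_eq_cexp ha, ofReal_cpow_eq_cexp ha', ofReal_cpow_eq_cexp hz,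
      ofReal_cpow_eq_cexp hz', ofReal_cpow_eq_cexp ha0, ofReal_cpow_eq_cexp two_pos]
    · simp only [← Complex.exp_add]
      rw [ofReal_cpow_eq_cexp ha']
      simp only [← Complex.exp_add]
      rw [Real.log_div (by positivity) hL₁.ne', Real.log_div (by positivity) hL₁.ne',
        Real.log_div hL₁.ne' hL₂.ne', Real.log_div (by positivity) hL₂.ne',
        Real.log_div (by positivity) hL₂.ne', Real.log_div (by positivity) (by positivity),
        Real.log_mul hL₁.ne' hL₂.ne', Real.log_mul (by positivity) hz.ne',
        Real.log_mul two_ne_zero (by positivity), Real.log_mul two_ne_zero (by positivity),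
        Real.log_mul two_ne_zero (by positivity),
        Real.log_mul ha.ne' ha'.ne', Real.log_mul ha'.ne' hz'.ne', Real.log_mul ha0.ne' hL₂.ne',
        hc, hq]
      congr 1
      push_cast
      ring
  · rintro ⟨a, z⟩ ⟨⟨ha0, ha1⟩, hz⟩
    simp only [Set.mem_Ioi] at ha0 ha1 hz
    refine ((HasPartialsAt.fst.mul ((HasPartialsAt.const 2).add
      (((HasPartialsAt.const 1).add .fst).mul .snd))).div (((HasPartialsAt.const 2).mul .fst).add
      (((HasPartialsAt.const 1).add .fst).mul .snd)) (by positivity)).congr_partials ?_ ?_ <;>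
      (simp only; congr 1; ring)
  · rintro ⟨a, z⟩ ⟨⟨ha0, ha1⟩, hz⟩
    simp only [Set.mem_Ioi] at ha0 ha1 hz
    refine ((((HasPartialsAt.const 2).mul .fst).add
      (((HasPartialsAt.const 1).add .fst).mul .snd)).div ((HasPartialsAt.const 2).add
      (((HasPartialsAt.const 1).add .fst).mul .snd)) (by positivity)).congr_partials ?_ ?_ <;>
      (simp only; congr 1; ring)

/-- `√(w / (1 + w))`, the sine attached to the variable of integration in the beta integral. -/
noncomputable def wSin (w : ℝ) : ℝ := √(w / (1 + w))

/-- `1 / √(1 + w)`, the cosine attached to the variable of integration in the beta integral. -/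
noncomputable def wCos (w : ℝ) : ℝ := 1 / √(1 + w)

theorem wSin_pos {w : ℝ} (hw : 0 < w) : 0 < wSin w := Real.sqrt_pos.2 (by positivity)

theorem wCos_pos {w : ℝ} (hw : 0 < w) : 0 < wCos w := by
  have : 0 < √(1 + w) := Real.sqrt_pos.2 (by positivity)
  exact one_div_pos.2 this

theorem image_quadrant :
    (fun p : ℝ × ℝ => (p.2 * (4 * p.1 + (1 + p.1) ^ 2 * p.2) / (4 * p.1 ^ 2 * (1 + p.2)),
      p.2 * (4 * p.1 + (1 + p.1) ^ 2 * p.2) / (4 * (1 + p.2)))) ''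
      (Set.Ioi (0 : ℝ) ×ˢ Set.Ioi (0 : ℝ)) = Set.Ioi (0 : ℝ) ×ˢ Set.Ioi (0 : ℝ) := by
  ext ⟨w, w'⟩
  simp only [Set.mem_image, Set.mem_prod, Set.mem_Ioi, Prod.mk.injEq, Prod.exists]
  constructor
  · rintro ⟨a, z, ⟨ha, hz⟩, rfl, rfl⟩
    constructor <;> positivity
  · rintro ⟨hw, hw'⟩
    set a := √(w' / w) with ha
    have ha0 : 0 < a := Real.sqrt_pos.2 (by positivity)
    have haw : a ^ 2 * w = w' := by
      rw [ha, Real.sq_sqrt (by positivity)]; field_simp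
    set K := (1 + a) ^ 2 with hK
    have hK0 : 0 < K := by positivity
    set b := 4 * a - 4 * w' with hb
    set Δ := √(b ^ 2 + 4 * K * (4 * w')) with hΔ
    have hΔ2 : Δ ^ 2 = b ^ 2 + 4 * K * (4 * w') := Real.sq_sqrt (by positivity)
    have hΔ0 : b < Δ := by
      refine (le_abs_self b).trans_lt ?_
      rw [← Real.sqrt_sq_eq_abs]
      exact Real.sqrt_lt_sqrt (by positivity) (by nlinarith [mul_pos hK0 hw'])
    set z := (Δ - b) / (2 * K) with hz
    have hz0 : 0 < z := div_pos (by linarith) (by positivity)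
    have hzK : 2 * K * z = Δ - b := by rw [hz]; field_simp
    have hquad : z * (4 * a + K * z) = 4 * w' * (1 + z) := by
      have h1 : (2 * K * z + b) ^ 2 = b ^ 2 + 4 * K * (4 * w') := by rw [hzK, ← hΔ2]; ring
      have h2 : 4 * K * (z * (4 * a + K * z) - 4 * w' * (1 + z)) = 0 := by
        rw [hb] at h1
        linear_combination h1
      have := (mul_eq_zero.1 h2).resolve_left (by positivity)
      linarith
    refine ⟨a, z, ⟨ha0, hz0⟩, ?_, ?_⟩
    · rw [hquad, div_eq_iff (by positivity), ← haw]; ring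
    · rw [hquad, div_eq_iff (by positivity)]; ring

theorem injOn_quadrant :
    Set.InjOn (fun p : ℝ × ℝ => (p.2 * (4 * p.1 + (1 + p.1) ^ 2 * p.2) /
      (4 * p.1 ^ 2 * (1 + p.2)), p.2 * (4 * p.1 + (1 + p.1) ^ 2 * p.2) / (4 * (1 + p.2))))
      (Set.Ioi (0 : ℝ) ×ˢ Set.Ioi (0 : ℝ)) := by
  rintro ⟨a, z⟩ ⟨ha, hz⟩ ⟨b, w⟩ ⟨hb, hw⟩ h
  rw [Set.mem_Ioi] at ha hz hb hw
  simp only at ha hz hb hw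
  simp only [Prod.mk.injEq] at h
  obtain ⟨h1, h2⟩ := h
  have e : ∀ a z : ℝ, 0 < a → 0 < z → z * (4 * a + (1 + a) ^ 2 * z) / (4 * (1 + z)) =
      a ^ 2 * (z * (4 * a + (1 + a) ^ 2 * z) / (4 * a ^ 2 * (1 + z))) := by
    intro a z ha hz
    field_simp
  have hab : a = b := by
    have h3 := h2
    rw [e a z ha hz, e b w hb hw, ← h1] at h3
    have h4 : 0 < z * (4 * a + (1 + a) ^ 2 * z) / (4 * a ^ 2 * (1 + z)) := by positivity
    have h5 := mul_right_cancel₀ h4.ne' h3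
    exact (pow_left_inj₀ ha.le hb.le two_ne_zero).1 h5
  subst hab
  rw [div_eq_div_iff (by positivity) (by positivity)] at h2
  have h3 : (z - w) * (4 * a + (1 + a) ^ 2 * (z + w + z * w)) = 0 := by
    linear_combination h2 / 4
  have h4 := (mul_eq_zero.1 h3).resolve_right (by positivity)
  rw [sub_eq_zero.1 h4]

/-- The integrand that remains after the `y`-integrals have been carried out. -/
noncomputable def quadrantKernel (d : ℕ) (r r' t : ℂ) (p : ℝ × ℝ) : ℂ :=
  ((2 * (1 + wCos p.1 * wCos p.2 + wSin p.1 * wSin p.2) : ℝ) : ℂ) ^ d *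
    ((wSin p.1 : ℂ) ^ (1 + 2 * r) * (wCos p.1 : ℂ) ^ (1 - 2 * r) * (p.1 : ℂ)⁻¹ *
      (wSin p.1 : ℂ) ^ (-(((d : ℂ) - 1) / 2 + 1 - r)) *
      (wCos p.1 : ℂ) ^ (-(((d : ℂ) - 1) / 2 + 1 + r))) *
    ((wSin p.2 : ℂ) ^ (1 + 2 * r') * (wCos p.2 : ℂ) ^ (1 - 2 * r') * (p.2 : ℂ)⁻¹ *
      (wSin p.2 : ℂ) ^ (-(((d : ℂ) - 1) / 2 + 1 - r')) *
      (wCos p.2 : ℂ) ^ (-(((d : ℂ) - 1) / 2 + 1 + r'))) *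
    (((wSin p.1)⁻¹ + (wSin p.2)⁻¹ : ℝ) : ℂ) ^ (-((d : ℂ) - 1 + 2 * t - r - r')) *
    (((wCos p.1)⁻¹ + (wCos p.2)⁻¹ : ℝ) : ℂ) ^ (-((d : ℂ) - 1 + t + r + r'))

theorem quadrantKernel_comp (d : ℕ) (r r' t : ℂ) {a z : ℝ} (ha : 0 < a) (hz : 0 < z) :
    ((z * (4 * a + (1 + a) ^ 2 * z) * ((2 * a + (1 + a) * z) * (2 + (1 + a) * z)) /
      (8 * a ^ 3 * (1 + z) ^ 3) : ℝ) : ℂ) *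
      quadrantKernel d r r' t (z * (4 * a + (1 + a) ^ 2 * z) / (4 * a ^ 2 * (1 + z)),
        z * (4 * a + (1 + a) ^ 2 * z) / (4 * (1 + z))) =
    2 ^ (2 + (d : ℂ) - t - r - r') *
      (((a : ℂ) ^ (((d : ℂ) - 1) / 2 + t - 2 * r + r' - 1) *
        ((1 + a : ℝ) : ℂ) ^ (-((d : ℂ) - 1 + 2 * t - r - r'))) *
      ((z : ℂ) ^ (t + r + r' - 1) * ((1 + z : ℝ) : ℂ) ^ (-(3 * t / 2)))) := by
  have hL₁ : 0 < 2 * a + (1 + a) * z := by positivity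
  have hL₂ : 0 < 2 + (1 + a) * z := by positivity
  have hL₃ : 0 < 4 * a + (1 + a) ^ 2 * z := by positivity
  have ha' : 0 < 1 + a := by positivity
  have hz' : 0 < 1 + z := by positivity
  set L₁ := 2 * a + (1 + a) * z with hL₁d
  set L₂ := 2 + (1 + a) * z with hL₂d
  set L₃ := 4 * a + (1 + a) ^ 2 * z with hL₃d
  have hs3 : 0 < √(z * L₃) := Real.sqrt_pos.2 (by positivity)
  have hsz : 0 < √(1 + z) := Real.sqrt_pos.2 (by positivity)
  have q3 : √(z * L₃) ^ 2 = z * L₃ := Real.sq_sqrt (by positivity)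
  have qz : √(1 + z) ^ 2 = 1 + z := Real.sq_sqrt (by positivity)
  have w1 : 1 + z * L₃ / (4 * a ^ 2 * (1 + z)) = (L₁ / (2 * a * √(1 + z))) ^ 2 := by
    rw [div_pow, mul_pow, qz]
    field_simp
    rw [hL₁d, hL₃d]
    ring
  have w2 : 1 + z * L₃ / (4 * (1 + z)) = (L₂ / (2 * √(1 + z))) ^ 2 := by
    rw [div_pow, mul_pow, qz]
    field_simp
    rw [hL₂d, hL₃d]
    ring
  have s1 : wSin (z * L₃ / (4 * a ^ 2 * (1 + z))) = √(z * L₃) / L₁ := by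
    rw [wSin, w1, Real.sqrt_eq_iff_mul_self_eq_of_pos (by positivity), ← sq, div_pow, q3,
      div_pow, mul_pow, qz]
    field_simp
    ring
  have s2 : wSin (z * L₃ / (4 * (1 + z))) = √(z * L₃) / L₂ := by
    rw [wSin, w2, Real.sqrt_eq_iff_mul_self_eq_of_pos (by positivity), ← sq, div_pow, q3,
      div_pow, mul_pow, qz]
    field_simp
    ring
  have c1 : wCos (z * L₃ / (4 * a ^ 2 * (1 + z))) = 2 * a * √(1 + z) / L₁ := by
    rw [wCos, w1, Real.sqrt_sq (by positivity), one_div_div]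
  have c2 : wCos (z * L₃ / (4 * (1 + z))) = 2 * √(1 + z) / L₂ := by
    rw [wCos, w2, Real.sqrt_sq (by positivity), one_div_div]
  have k1 : 2 * (1 + 2 * a * √(1 + z) / L₁ * (2 * √(1 + z) / L₂) +
      √(z * L₃) / L₁ * (√(z * L₃) / L₂)) = 2 * (2 * (1 + z) * L₃) / (L₁ * L₂) := by
    field_simp
    rw [q3, qz, hL₁d, hL₂d, hL₃d]
    ring
  have k2 : (√(z * L₃) / L₁)⁻¹ + (√(z * L₃) / L₂)⁻¹ = 2 * ((1 + a) * (1 + z)) / √(z * L₃) := by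
    field_simp
    rw [hL₁d, hL₂d]
    ring
  have k3 : (2 * a * √(1 + z) / L₁)⁻¹ + (2 * √(1 + z) / L₂)⁻¹ = L₃ / (2 * a * √(1 + z)) := by
    field_simp
    rw [hL₁d, hL₂d, hL₃d]
    ring
  have ex : ∀ x : ℝ, 0 < x → (x : ℂ) = cexp (Real.log x) := fun x hx => by
    rw [← ofReal_exp, Real.exp_log hx]
  have exi : ∀ x : ℝ, 0 < x → (x : ℂ)⁻¹ = cexp (-Real.log x) := fun x hx => by
    rw [Complex.exp_neg, ← ex x hx]
  have two : (2 : ℂ) ^ (2 + (d : ℂ) - t - r - r') =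
      cexp (Real.log 2 * (2 + (d : ℂ) - t - r - r')) := by
    rw [← ofReal_cpow_eq_cexp two_pos]; norm_num
  have l4 : Real.log 4 = 2 * Real.log 2 := by
    rw [show (4 : ℝ) = 2 ^ 2 by norm_num, Real.log_pow]; norm_num
  have l8 : Real.log 8 = 3 * Real.log 2 := by
    rw [show (8 : ℝ) = 2 ^ 3 by norm_num, Real.log_pow]; norm_num
  rw [quadrantKernel]
  simp only [s1, s2, c1, c2, k1, k2, k3]
  rw [← Complex.cpow_natCast, two, ex _ (by positivity : 0 < z * L₃ * (L₁ * L₂) / (8 * a ^ 3 * (1 + z) ^ 3)),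
    exi (z * L₃ / (4 * a ^ 2 * (1 + z))) (by positivity),
    exi (z * L₃ / (4 * (1 + z))) (by positivity)]
  have m1 : 0 < 2 * (2 * (1 + z) * L₃) / (L₁ * L₂) := by positivity
  have m2 : 0 < 2 * ((1 + a) * (1 + z)) / √(z * L₃) := by positivity
  have m3 : 0 < L₃ / (2 * a * √(1 + z)) := by positivity
  have m4 : 0 < √(z * L₃) / L₁ := by positivity
  have m5 : 0 < √(z * L₃) / L₂ := by positivity
  have m6 : 0 < 2 * a * √(1 + z) / L₁ := by positivity
  have m7 : 0 < 2 * √(1 + z) / L₂ := by positivity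
  simp only [ofReal_cpow_eq_cexp m1, ofReal_cpow_eq_cexp m2, ofReal_cpow_eq_cexp m3,
    ofReal_cpow_eq_cexp m4, ofReal_cpow_eq_cexp m5, ofReal_cpow_eq_cexp m6,
    ofReal_cpow_eq_cexp m7, ofReal_cpow_eq_cexp ha, ofReal_cpow_eq_cexp ha',
    ofReal_cpow_eq_cexp hz, ofReal_cpow_eq_cexp hz', ← Complex.exp_add]
  have n1 : Real.log (2 * (2 * (1 + z) * L₃) / (L₁ * L₂)) = 2 * Real.log 2 + Real.log (1 + z) +
      Real.log L₃ - Real.log L₁ - Real.log L₂ := by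
    rw [Real.log_div (by positivity) (by positivity), Real.log_mul (by positivity) (by positivity),
      Real.log_mul (by positivity) (by positivity), Real.log_mul (by positivity) (by positivity),
      Real.log_mul (by positivity) (by positivity)]
    ring
  have n2 : Real.log (2 * ((1 + a) * (1 + z)) / √(z * L₃)) = Real.log 2 + Real.log (1 + a) +
      Real.log (1 + z) - (Real.log z + Real.log L₃) / 2 := by
    rw [Real.log_div (by positivity) (by positivity), Real.log_mul (by positivity) (by positivity),
      Real.log_mul (by positivity) (by positivity), Real.log_sqrt (by positivity),
      Real.log_mul (by positivity) (by positivity)]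
    ring
  have n3 : Real.log (L₃ / (2 * a * √(1 + z))) = Real.log L₃ - Real.log 2 - Real.log a -
      Real.log (1 + z) / 2 := by
    rw [Real.log_div (by positivity) (by positivity), Real.log_mul (by positivity) (by positivity),
      Real.log_mul (by positivity) (by positivity), Real.log_sqrt (by positivity)]
    ring
  have n4 : ∀ L, 0 < L → Real.log (√(z * L₃) / L) =
      (Real.log z + Real.log L₃) / 2 - Real.log L := by
    intro L hL
    rw [Real.log_div (by positivity) (by positivity), Real.log_sqrt (by positivity),
      Real.log_mul (by positivity) (by positivity)]
  have n6 : Real.log (2 * a * √(1 + z) / L₁) = Real.log 2 + Real.log a + Real.log (1 + z) / 2 -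
      Real.log L₁ := by
    rw [Real.log_div (by positivity) (by positivity), Real.log_mul (by positivity) (by positivity),
      Real.log_mul (by positivity) (by positivity), Real.log_sqrt (by positivity)]
  have n7 : Real.log (2 * √(1 + z) / L₂) = Real.log 2 + Real.log (1 + z) / 2 - Real.log L₂ := by
    rw [Real.log_div (by positivity) (by positivity), Real.log_mul (by positivity) (by positivity),
      Real.log_sqrt (by positivity)]
  have n8 : Real.log (z * L₃ / (4 * a ^ 2 * (1 + z))) = Real.log z + Real.log L₃ -
      2 * Real.log 2 - 2 * Real.log a - Real.log (1 + z) := by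
    rw [Real.log_div (by positivity) (by positivity), Real.log_mul (by positivity) (by positivity),
      Real.log_mul (by positivity) (by positivity), Real.log_mul (by positivity) (by positivity),
      l4, Real.log_pow]
    push_cast
    ring
  have n9 : Real.log (z * L₃ / (4 * (1 + z))) = Real.log z + Real.log L₃ -
      2 * Real.log 2 - Real.log (1 + z) := by
    rw [Real.log_div (by positivity) (by positivity), Real.log_mul (by positivity) (by positivity),
      Real.log_mul (by positivity) (by positivity), l4]
    ring
  have n0 : Real.log (z * L₃ * (L₁ * L₂) / (8 * a ^ 3 * (1 + z) ^ 3)) = Real.log z + Real.log L₃ +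
      Real.log L₁ + Real.log L₂ - 3 * Real.log 2 - 3 * Real.log a - 3 * Real.log (1 + z) := by
    rw [Real.log_div (by positivity) (by positivity), Real.log_mul (by positivity) (by positivity),
      Real.log_mul (by positivity) (by positivity), Real.log_mul (by positivity) (by positivity),
      Real.log_mul (by positivity) (by positivity), Real.log_mul (by positivity) (by positivity),
      l8, Real.log_pow, Real.log_pow]
    push_cast
    ring
  rw [n0, n1, n2, n3, n4 _ hL₁, n4 _ hL₂, n6, n7, n8, n9]
  congr 1
  push_cast
  ring

theorem integral_quadrantKernel (d : ℕ) {r r' t : ℂ} (h₁ : 0 < (t + r + r').re)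
    (h₂ : 0 < (t / 2 - r - r').re) (hB : 0 < (((d : ℂ) - 1) / 2 + t - 2 * r + r').re)
    (hB' : 0 < (((d : ℂ) - 1) / 2 + t - 2 * r' + r).re) :
    IntegrableOn (quadrantKernel d r r' t) (Set.Ioi (0 : ℝ) ×ˢ Set.Ioi (0 : ℝ)) ∧
    ∫ p in Set.Ioi (0 : ℝ) ×ˢ Set.Ioi (0 : ℝ), quadrantKernel d r r' t p =
      2 ^ (2 + (d : ℂ) - t - r - r') *
        ((Complex.Gamma (((d : ℂ) - 1) / 2 + t - 2 * r + r') *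
          Complex.Gamma (((d : ℂ) - 1) / 2 + t - 2 * r' + r) /
            Complex.Gamma ((d : ℂ) - 1 + 2 * t - r - r')) *
        (Complex.Gamma (t + r + r') * Complex.Gamma (t / 2 - r - r') /
          Complex.Gamma (3 * t / 2))) := by
  have hms : MeasurableSet (Set.Ioi (0 : ℝ) ×ˢ Set.Ioi (0 : ℝ)) :=
    measurableSet_Ioi.prod measurableSet_Ioi
  set f : ℝ × ℝ → ℝ := fun p =>
    p.2 * (4 * p.1 + (1 + p.1) ^ 2 * p.2) / (4 * p.1 ^ 2 * (1 + p.2)) with hf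
  set g : ℝ × ℝ → ℝ := fun p =>
    p.2 * (4 * p.1 + (1 + p.1) ^ 2 * p.2) / (4 * (1 + p.2)) with hg
  set ga : ℝ × ℝ → ℝ := fun p => p.2 * (4 + 2 * (1 + p.1) * p.2) / (4 * (1 + p.2)) with hga
  set gz : ℝ × ℝ → ℝ := fun p =>
    (2 * p.1 + (1 + p.1) * p.2) * (2 + (1 + p.1) * p.2) / (4 * (1 + p.2) ^ 2) with hgz
  set fa : ℝ × ℝ → ℝ := fun p => ga p / p.1 ^ 2 - 2 * g p / p.1 ^ 3 with hfa
  set fz : ℝ × ℝ → ℝ := fun p => gz p / p.1 ^ 2 with hfz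
  have hnum : ∀ p : ℝ × ℝ, HasPartialsAt (fun p => p.2 * (4 * p.1 + (1 + p.1) ^ 2 * p.2))
      (p.2 * (4 + 2 * (1 + p.1) * p.2)) (4 * p.1 + 2 * (1 + p.1) ^ 2 * p.2) p := by
    intro p
    have h : (fun p : ℝ × ℝ => p.2 * (4 * p.1 + (1 + p.1) ^ 2 * p.2)) =
        fun p => p.2 * (4 * p.1 + (1 + p.1) * (1 + p.1) * p.2) := by
      ext q
      ring
    rw [h]
    refine (HasPartialsAt.snd.mul (((HasPartialsAt.const 4).mul .fst).add
      ((((HasPartialsAt.const 1).add .fst).mul ((HasPartialsAt.const 1).add .fst)).mul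
        .snd))).congr_partials ?_ ?_ <;> ring
  have hpg : ∀ p ∈ Set.Ioi (0 : ℝ) ×ˢ Set.Ioi (0 : ℝ), HasPartialsAt g (ga p) (gz p) p := by
    rintro ⟨a, z⟩ ⟨ha, hz⟩
    simp only [Set.mem_Ioi] at ha hz
    refine ((hnum (a, z)).div ((HasPartialsAt.const 4).mul ((HasPartialsAt.const 1).add .snd))
      (by positivity)).congr_partials ?_ ?_
    · simp only [hga]
      field_simp
      ring
    · simp only [hgz]
      field_simp
      ring
  have hpf : ∀ p ∈ Set.Ioi (0 : ℝ) ×ˢ Set.Ioi (0 : ℝ), HasPartialsAt f (fa p) (fz p) p := by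
    rintro ⟨a, z⟩ ⟨ha, hz⟩
    simp only [Set.mem_Ioi] at ha hz
    have h : f = fun p => p.2 * (4 * p.1 + (1 + p.1) ^ 2 * p.2) /
        (4 * (p.1 * (p.1 * (1 + p.2)))) := by
      ext q
      simp only [hf]
      ring
    rw [h]
    refine ((hnum (a, z)).div ((HasPartialsAt.const 4).mul
      ((HasPartialsAt.fst).mul (HasPartialsAt.fst.mul ((HasPartialsAt.const 1).add .snd))))
      (by positivity)).congr_partials ?_ ?_
    · simp only [hfa, hga, hg]
      field_simp
      ring
    · simp only [hfz, hgz]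
      field_simp
      ring
  have hcomp : ∀ p ∈ Set.Ioi (0 : ℝ) ×ˢ Set.Ioi (0 : ℝ),
      ((|fa p * gz p - fz p * ga p| : ℝ) : ℂ) * quadrantKernel d r r' t (f p, g p) =
      2 ^ (2 + (d : ℂ) - t - r - r') *
      (((p.1 : ℂ) ^ (((d : ℂ) - 1) / 2 + t - 2 * r + r' - 1) *
        ((1 + p.1 : ℝ) : ℂ) ^ (-((d : ℂ) - 1 + 2 * t - r - r'))) *
      ((p.2 : ℂ) ^ (t + r + r' - 1) * ((1 + p.2 : ℝ) : ℂ) ^ (-(3 * t / 2)))) := by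
    rintro ⟨a, z⟩ ⟨ha, hz⟩
    simp only [Set.mem_Ioi] at ha hz
    rw [← quadrantKernel_comp d r r' t ha hz]
    congr 2
    rw [← abs_of_pos (a := z * (4 * a + (1 + a) ^ 2 * z) * ((2 * a + (1 + a) * z) *
      (2 + (1 + a) * z)) / (8 * a ^ 3 * (1 + z) ^ 3)) (by positivity), ← abs_neg]
    congr 1
    simp only [hfa, hfz, hga, hgz, hg]
    field_simp
    ring
  have i₁ := integral_Ioi_beta (a := ((d : ℂ) - 1) / 2 + t - 2 * r + r')
    (b := ((d : ℂ) - 1) / 2 + t - 2 * r' + r) hB hB'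
  have i₂ := integral_Ioi_beta (a := t + r + r') (b := t / 2 - r - r') h₁ h₂
  rw [show ((d : ℂ) - 1) / 2 + t - 2 * r + r' + (((d : ℂ) - 1) / 2 + t - 2 * r' + r) =
    (d : ℂ) - 1 + 2 * t - r - r' by ring] at i₁
  rw [show t + r + r' + (t / 2 - r - r') = 3 * t / 2 by ring] at i₂
  have hinj : Set.InjOn (fun p => (f p, g p)) (Set.Ioi (0 : ℝ) ×ˢ Set.Ioi (0 : ℝ)) :=
    injOn_quadrant
  have himg : (fun p => (f p, g p)) '' (Set.Ioi (0 : ℝ) ×ˢ Set.Ioi (0 : ℝ)) =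
    Set.Ioi (0 : ℝ) ×ˢ Set.Ioi (0 : ℝ) := image_quadrant
  constructor
  · have h := integrableOn_image_prodMk_iff hms hpf hpg hinj (quadrantKernel d r r' t)
    rw [himg] at h
    rw [h]
    refine IntegrableOn.congr_fun ?_ (fun p hp => (hcomp p hp).symm) hms
    rw [IntegrableOn, Measure.volume_eq_prod, ← Measure.prod_restrict]
    exact (Integrable.mul_prod i₁.1 i₂.1).const_mul _
  · have h := integral_image_prodMk hms hpf hpg hinj (quadrantKernel d r r' t)
    rw [himg] at h
    rw [h, setIntegral_congr_fun hms hcomp, integral_const_mul, Measure.volume_eq_prod,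
      setIntegral_prod_mul (fun a : ℝ => (a : ℂ) ^ (((d : ℂ) - 1) / 2 + t - 2 * r + r' - 1) *
        ((1 + a : ℝ) : ℂ) ^ (-((d : ℂ) - 1 + 2 * t - r - r')))
        (fun z : ℝ => (z : ℂ) ^ (t + r + r' - 1) * ((1 + z : ℝ) : ℂ) ^ (-(3 * t / 2))),
      i₁.2, i₂.2]

@[fun_prop]
theorem measurable_wSin : Measurable wSin := by
  unfold wSin
  fun_prop

@[fun_prop]
theorem measurable_wCos : Measurable wCos := by
  unfold wCos
  fun_prop

theorem log_wSin {w : ℝ} (hw : 0 < w) :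
    Real.log (wSin w) = (Real.log w - Real.log (1 + w)) / 2 := by
  rw [wSin, Real.log_sqrt (by positivity), Real.log_div hw.ne' (by positivity)]

theorem log_wCos {w : ℝ} (hw : 0 < w) : Real.log (wCos w) = -Real.log (1 + w) / 2 := by
  rw [wCos, one_div, Real.log_inv, Real.log_sqrt (by positivity)]
  ring

/-- The factor of the integrand of the Whittaker function that comes from Mellin inversion. -/
noncomputable def whittakerExp (z₁ z₂ : ℂ) (x₁ x₂ w : ℝ) : ℂ :=
  ((x₁ / wSin w : ℝ) : ℂ) ^ z₁ * cexp (-(x₁ / wSin w : ℝ)) *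
    (((x₂ / wCos w : ℝ) : ℂ) ^ z₂ * cexp (-(x₂ / wCos w : ℝ)))

theorem integral_Gamma_Gamma_beta {z₁ z₂ α β : ℂ} (hz₁ : 0 < z₁.re) (hz₂ : 0 < z₂.re)
    (hα : 0 < α.re) (hβ : 0 < β.re) {x₁ x₂ : ℝ} (hx₁ : 0 < x₁) (hx₂ : 0 < x₂) :
    IntegrableOn (fun w : ℝ => (wSin w : ℂ) ^ α * (wCos w : ℂ) ^ β * (w : ℂ)⁻¹ *
      whittakerExp z₁ z₂ x₁ x₂ w) (Set.Ioi 0) ∧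
    ∫ t : ℝ × ℝ, (x₁ : ℂ) ^ (-(I * t.1)) * (x₂ : ℂ) ^ (-(I * t.2)) *
        Complex.Gamma (z₁ + I * t.1) * Complex.Gamma (z₂ + I * t.2) *
        cBeta ((α + I * t.1) / 2) ((β + I * t.2) / 2) =
      (2 * π) ^ 2 * ∫ w in Set.Ioi (0 : ℝ), (wSin w : ℂ) ^ α * (wCos w : ℂ) ^ β * (w : ℂ)⁻¹ *
        whittakerExp z₁ z₂ x₁ x₂ w := by
  set Φ : ℝ × ℝ → ℂ := fun t => Complex.Gamma (z₁ + I * t.1) * Complex.Gamma (z₂ + I * t.2) with hΦ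
  have hΦi : Integrable Φ :=
    (integrable_Gamma_vertical hz₁).mul_prod (integrable_Gamma_vertical hz₂)
  set Ξ : ℝ → ℂ := fun w => (w : ℂ) ^ (α / 2 - 1) * ((1 + w : ℝ) : ℂ) ^ (-(α / 2 + β / 2)) with hΞ
  have hΞi : IntegrableOn Ξ (Set.Ioi 0) :=
    (integral_Ioi_beta (by simpa using hα) (by simpa using hβ)).1
  set E : (ℝ × ℝ) × ℝ → ℂ := fun p => cexp (((-(p.1.1 * Real.log (x₁ / wSin p.2) +
    p.1.2 * Real.log (x₂ / wCos p.2)) : ℝ) : ℂ) * I) with hE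
  have hEm : Measurable E := by fun_prop
  have hG := integrable_prod_mul_unimodular hΦi hΞi hEm
    fun w => (Complex.norm_exp_ofReal_mul_I _).le
  have hw_eq : ∀ w ∈ Set.Ioi (0 : ℝ), ∫ t, Φ t * Ξ w * E (t, w) =
      (2 * π) ^ 2 * ((wSin w : ℂ) ^ α * (wCos w : ℂ) ^ β * (w : ℂ)⁻¹ *
        whittakerExp z₁ z₂ x₁ x₂ w) := by
    intro w hw
    have hw0 : 0 < w := hw
    have hs := wSin_pos hw0
    have hc := wCos_pos hw0
    have h1w : 0 < 1 + w := by linarith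
    have e0 : ∀ t : ℝ × ℝ, Φ t * Ξ w * E (t, w) = Ξ w *
        ((((x₁ / wSin w : ℝ) : ℂ) ^ (-(I * t.1)) * Complex.Gamma (z₁ + I * t.1)) *
        (((x₂ / wCos w : ℝ) : ℂ) ^ (-(I * t.2)) * Complex.Gamma (z₂ + I * t.2))) := by
      intro t
      have : E (t, w) = ((x₁ / wSin w : ℝ) : ℂ) ^ (-(I * t.1)) *
          ((x₂ / wCos w : ℝ) : ℂ) ^ (-(I * t.2)) := by
        rw [ofReal_cpow_eq_cexp (by positivity), ofReal_cpow_eq_cexp (by positivity),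
          ← Complex.exp_add]
        simp only [hE]
        congr 1
        push_cast
        ring
      rw [this]
      simp only [hΦ]
      ring
    simp only [e0]
    rw [integral_const_mul, Measure.volume_eq_prod, integral_prod_mul
      (fun a : ℝ => ((x₁ / wSin w : ℝ) : ℂ) ^ (-(I * a)) * Complex.Gamma (z₁ + I * a))
      (fun b : ℝ => ((x₂ / wCos w : ℝ) : ℂ) ^ (-(I * b)) * Complex.Gamma (z₂ + I * b)),
      integral_Gamma_vertical_mul_cpow hz₁ (by positivity),
      integral_Gamma_vertical_mul_cpow hz₂ (by positivity)]
    have : Ξ w = (wSin w : ℂ) ^ α * (wCos w : ℂ) ^ β * (w : ℂ)⁻¹ := by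
      have hwi : (w : ℂ)⁻¹ = cexp (-Real.log w) := by
        rw [Complex.exp_neg, ← ofReal_exp, Real.exp_log hw0]
      simp only [hΞ]
      rw [ofReal_cpow_eq_cexp hw0, ofReal_cpow_eq_cexp h1w, ofReal_cpow_eq_cexp hs,
        ofReal_cpow_eq_cexp hc, hwi, ← Complex.exp_add, ← Complex.exp_add, ← Complex.exp_add,
        log_wSin hw0, log_wCos hw0]
      congr 1
      push_cast
      ring
    rw [this, whittakerExp]
    ring
  have ht_eq : ∀ t : ℝ × ℝ, ∫ w in Set.Ioi (0 : ℝ), Φ t * Ξ w * E (t, w) =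
      (x₁ : ℂ) ^ (-(I * t.1)) * (x₂ : ℂ) ^ (-(I * t.2)) *
        Complex.Gamma (z₁ + I * t.1) * Complex.Gamma (z₂ + I * t.2) *
        cBeta ((α + I * t.1) / 2) ((β + I * t.2) / 2) := by
    intro t
    have h := (integral_Ioi_beta (a := (α + I * t.1) / 2) (b := (β + I * t.2) / 2)
      (by simpa using hα) (by simpa using hβ)).2
    rw [cBeta, ← h, ← integral_const_mul]
    refine setIntegral_congr_fun measurableSet_Ioi fun w hw => ?_
    have hw0 : 0 < w := hw
    have hs := wSin_pos hw0
    have hc := wCos_pos hw0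
    have h1w : 0 < 1 + w := by linarith
    have key : Ξ w * E (t, w) = (x₁ : ℂ) ^ (-(I * t.1)) * (x₂ : ℂ) ^ (-(I * t.2)) *
        ((w : ℂ) ^ ((α + I * t.1) / 2 - 1) *
          ((1 + w : ℝ) : ℂ) ^ (-((α + I * t.1) / 2 + (β + I * t.2) / 2))) := by
      simp only [hΞ, hE]
      rw [ofReal_cpow_eq_cexp hw0, ofReal_cpow_eq_cexp h1w, ofReal_cpow_eq_cexp hx₁,
        ofReal_cpow_eq_cexp hx₂, ofReal_cpow_eq_cexp hw0, ofReal_cpow_eq_cexp h1w,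
        Real.log_div hx₁.ne' hs.ne', Real.log_div hx₂.ne' hc.ne', log_wSin hw0, log_wCos hw0]
      simp only [← Complex.exp_add]
      congr 1
      push_cast
      ring
    simp only [hΦ]
    rw [mul_assoc, key]
    ring
  constructor
  · have h := hG.integral_prod_right.const_mul (((2 * π : ℂ) ^ 2)⁻¹)
    refine IntegrableOn.congr_fun h (fun w hw => ?_) measurableSet_Ioi
    have h2 : ((2 * π : ℂ) ^ 2) ≠ 0 := by
      have : (π : ℂ) ≠ 0 := by exact_mod_cast pi_ne_zero
      simp [this]
    simp only
    rw [hw_eq w hw, inv_mul_cancel_left₀ h2]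
  · simp only [← ht_eq]
    rw [integral_integral_swap hG, ← integral_const_mul]
    exact setIntegral_congr_fun measurableSet_Ioi hw_eq

/-- The part of the integrand of the Whittaker function that depends on the weight `m'`. -/
noncomputable def whittakerWeight (d : ℕ) (m' : ℤ) (w : ℝ) : ℝ :=
  (1 + (if 0 ≤ m' then 1 else -1) * wCos w) ^ m'.natAbs * wSin w ^ (d - m'.natAbs)

/-- The part of the integrand of the Whittaker function that does not depend on the weight. -/
noncomputable def whittakerKernel (d : ℕ) (r : ℂ) (y₁ y₂ w : ℝ) : ℂ :=
  (wSin w : ℂ) ^ (1 + 2 * r) * (wCos w : ℂ) ^ (1 - 2 * r) * (w : ℂ)⁻¹ *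
    whittakerExp (((d : ℂ) - 1) / 2 + 1 - r) (((d : ℂ) - 1) / 2 + 1 + r)
      (2 * π * y₁) (2 * π * y₂) w

theorem Wstar_eq {d : ℕ} (hd : 2 ≤ d) {r : ℂ} (hr : r.re = 0) {y₁ y₂ : ℝ} (hy₁ : 0 < y₁)
    (hy₂ : 0 < y₂) {m' : ℤ} (hm : m'.natAbs ≤ d) :
    IntegrableOn (fun w => (whittakerWeight d m' w : ℂ) * whittakerKernel d r y₁ y₂ w)
      (Set.Ioi 0) ∧
    Wstar d r y₁ y₂ m' = ((2 : ℂ) ^ (d + 1) * (π : ℂ))⁻¹ *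
      (√((2 * d).choose (d + m'.natAbs)) : ℂ) *
      ∫ w in Set.Ioi (0 : ℝ), (whittakerWeight d m' w : ℂ) * whittakerKernel d r y₁ y₂ w := by
  set m := m'.natAbs with hmdef
  set ε : ℝ := if 0 ≤ m' then 1 else -1 with hε
  have hεc : (if 0 ≤ m' then (1 : ℂ) else -1) = (ε : ℂ) := by
    rw [hε]; split_ifs <;> simp
  have hd' : (2 : ℝ) ≤ d := by exact_mod_cast hd
  have hmd : (m : ℝ) ≤ d := by exact_mod_cast hm
  have hdre : (((d : ℂ) - 1) / 2).re = ((d : ℝ) - 1) / 2 := by simp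
  have key := fun ℓ : ℕ => integral_Gamma_Gamma_beta (z₁ := ((d : ℂ) - 1) / 2 + 1 - r)
    (z₂ := ((d : ℂ) - 1) / 2 + 1 + r) (α := d - m + 1 + 2 * r) (β := ℓ + 1 - 2 * r)
    (by rw [sub_re, add_re, hdre, hr]; simp; linarith)
    (by rw [add_re, add_re, hdre, hr]; simp; linarith)
    (by simp [hr]; linarith) (by simp [hr]; positivity)
    (show 0 < 2 * π * y₁ by positivity) (show 0 < 2 * π * y₂ by positivity)
  have hker : ∀ ℓ : ℕ, ∀ w ∈ Set.Ioi (0 : ℝ),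
      (wSin w : ℂ) ^ ((d : ℂ) - m + 1 + 2 * r) * (wCos w : ℂ) ^ ((ℓ : ℂ) + 1 - 2 * r) * (w : ℂ)⁻¹ *
        whittakerExp (((d : ℂ) - 1) / 2 + 1 - r) (((d : ℂ) - 1) / 2 + 1 + r)
          (2 * π * y₁) (2 * π * y₂) w =
      (wSin w : ℂ) ^ (d - m) * (wCos w : ℂ) ^ ℓ * whittakerKernel d r y₁ y₂ w := by
    intro ℓ w hw
    have hs : (wSin w : ℂ) ≠ 0 := by exact_mod_cast (wSin_pos hw).ne'
    have hc : (wCos w : ℂ) ≠ 0 := by exact_mod_cast (wCos_pos hw).ne'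
    rw [show (d : ℂ) - m + 1 + 2 * r = ((d - m : ℕ) : ℂ) + (1 + 2 * r) by
        rw [Nat.cast_sub hm]; ring,
      show (ℓ : ℂ) + 1 - 2 * r = (ℓ : ℂ) + (1 - 2 * r) by ring, Complex.cpow_add _ _ hs,
      Complex.cpow_add _ _ hc, Complex.cpow_natCast, Complex.cpow_natCast, whittakerKernel]
    ring
  have hInt : ∀ ℓ : ℕ, IntegrableOn (fun w => (wSin w : ℂ) ^ (d - m) * (wCos w : ℂ) ^ ℓ *
      whittakerKernel d r y₁ y₂ w) (Set.Ioi 0) := fun ℓ =>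
    IntegrableOn.congr_fun (key ℓ).1 (hker ℓ) measurableSet_Ioi
  have hsum : ∀ w, (whittakerWeight d m' w : ℂ) * whittakerKernel d r y₁ y₂ w =
      ∑ ℓ ∈ Finset.range (m + 1), ((ε : ℂ) ^ ℓ * (m.choose ℓ : ℂ)) *
        ((wSin w : ℂ) ^ (d - m) * (wCos w : ℂ) ^ ℓ * whittakerKernel d r y₁ y₂ w) := by
    intro w
    rw [whittakerWeight, ← hmdef, ← hε, add_comm (1 : ℝ)]
    push_cast
    rw [add_pow, Finset.sum_mul, Finset.sum_mul]
    refine Finset.sum_congr rfl fun ℓ _ => ?_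
    rw [mul_pow, one_pow]
    ring
  simp only [hsum]
  refine ⟨integrable_finsetSum _ fun ℓ _ => (hInt ℓ).const_mul _, ?_⟩
  rw [integral_finsetSum _ fun ℓ _ => (hInt ℓ).const_mul _, Wstar, ← hmdef, hεc]
  congr 1
  refine Finset.sum_congr rfl fun ℓ _ => ?_
  have h2 : ((2 * π : ℂ)) ≠ 0 := by
    have : (π : ℂ) ≠ 0 := by exact_mod_cast pi_ne_zero
    simp [this]
  have hI : ∀ t : ℝ × ℝ,
      ((2 * π * y₁ : ℝ) : ℂ) ^ (1 - ((1 : ℂ) + I * t.1)) *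
        ((2 * π * y₂ : ℝ) : ℂ) ^ (1 - ((1 : ℂ) + I * t.2)) *
        Complex.Gamma (((d : ℂ) - 1) / 2 + ((1 : ℂ) + I * t.1) - r) *
        Complex.Gamma (((d : ℂ) - 1) / 2 + ((1 : ℂ) + I * t.2) + r) *
        cBeta (((d : ℂ) - (m : ℂ) + ((1 : ℂ) + I * t.1) + 2 * r) / 2)
          (((ℓ : ℂ) + ((1 : ℂ) + I * t.2) - 2 * r) / 2) =
      ((2 * π * y₁ : ℝ) : ℂ) ^ (-(I * t.1)) * ((2 * π * y₂ : ℝ) : ℂ) ^ (-(I * t.2)) *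
        Complex.Gamma (((d : ℂ) - 1) / 2 + 1 - r + I * t.1) *
        Complex.Gamma (((d : ℂ) - 1) / 2 + 1 + r + I * t.2) *
        cBeta (((d : ℂ) - m + 1 + 2 * r + I * t.1) / 2) (((ℓ : ℂ) + 1 - 2 * r + I * t.2) / 2) := by
    intro t
    congr 1
    · congr 1
      · congr 1
        · congr 2 <;> ring
        · congr 1; ring
      · congr 1; ring
    · congr 1 <;> ring
  simp only [hI]
  rw [(key ℓ).2, setIntegral_congr_fun measurableSet_Ioi (hker ℓ), integral_const_mul,
    mul_assoc, mul_assoc, mul_assoc]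
  congr 2
  rw [← mul_assoc, ofReal_mul, ofReal_ofNat, inv_pow, inv_mul_cancel₀ (pow_ne_zero 2 h2), one_mul]

theorem wCos_lt_one {w : ℝ} (hw : 0 < w) : wCos w < 1 := by
  rw [wCos, div_lt_one (Real.sqrt_pos.2 (by positivity)), Real.lt_sqrt zero_le_one]
  linarith

theorem wSin_eq_sqrt_mul_sqrt {w : ℝ} (hw : 0 < w) :
    wSin w = √(1 + wCos w) * √(1 - wCos w) := by
  have h0 := wCos_pos hw
  rw [← Real.sqrt_mul (by linarith), wSin]
  congr 1
  have : wCos w ^ 2 = 1 / (1 + w) := by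
    rw [wCos, div_pow, Real.sq_sqrt (by positivity), one_pow]
  rw [show (1 + wCos w) * (1 - wCos w) = 1 - wCos w ^ 2 by ring, this]
  field_simp
  ring

theorem whittakerWeight_eq {d : ℕ} {m' : ℤ} (hm : m'.natAbs ≤ d) {w : ℝ} (hw : 0 < w) :
    whittakerWeight d m' w =
      √(1 + wCos w) ^ (d + m').toNat * √(1 - wCos w) ^ (d - m').toNat := by
  have h1 : √(1 + wCos w) ^ 2 = 1 + wCos w := Real.sq_sqrt (by linarith [wCos_pos hw])
  have h2 : √(1 - wCos w) ^ 2 = 1 - wCos w := Real.sq_sqrt (by linarith [wCos_lt_one hw])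
  rw [whittakerWeight, wSin_eq_sqrt_mul_sqrt hw, mul_pow]
  split_ifs with h
  · rw [show (d + m').toNat = 2 * m'.natAbs + (d - m'.natAbs) by omega,
      show (d - m').toNat = d - m'.natAbs by omega, pow_add, pow_mul, h1]
    ring
  · rw [show (d - m').toNat = 2 * m'.natAbs + (d - m'.natAbs) by omega,
      show (d + m').toNat = d - m'.natAbs by omega, pow_add, pow_mul, h2]
    ring

theorem sum_choose_mul_whittakerWeight (d : ℕ) {w w' : ℝ} (hw : 0 < w) (hw' : 0 < w') :
    ∑ m' ∈ Finset.Icc (-(d : ℤ)) d, ((2 * d).choose (d + m'.natAbs) : ℝ) *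
      (whittakerWeight d m' w * whittakerWeight d m' w') =
    (2 * (1 + wCos w * wCos w' + wSin w * wSin w')) ^ d := by
  have h : ∑ m' ∈ Finset.Icc (-(d : ℤ)) d, ((2 * d).choose (d + m'.natAbs) : ℝ) *
      (whittakerWeight d m' w * whittakerWeight d m' w') =
      ∑ j ∈ Finset.range (2 * d + 1), (√(1 + wCos w) * √(1 + wCos w')) ^ j *
        (√(1 - wCos w) * √(1 - wCos w')) ^ (2 * d - j) * ((2 * d).choose j : ℝ) := by
    refine Finset.sum_nbij' (fun m' => (d + m').toNat) (fun j => (j : ℤ) - d) ?_ ?_ ?_ ?_ ?_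
    · intro m' hm
      rw [Finset.mem_Icc] at hm
      rw [Finset.mem_range]
      omega
    · intro j hj
      rw [Finset.mem_range] at hj
      rw [Finset.mem_Icc]
      omega
    · intro m' hm
      rw [Finset.mem_Icc] at hm
      omega
    · intro j hj
      omega
    · intro m' hm
      rw [Finset.mem_Icc] at hm
      have hmd : m'.natAbs ≤ d := by omega
      have hch : (2 * d).choose (d + m'.natAbs) = (2 * d).choose (d + m').toNat := by
        rcases le_total 0 m' with h | h
        · congr 1; omega
        · rw [← Nat.choose_symm (by omega)]
          congr 1; omega
      rw [whittakerWeight_eq hmd hw, whittakerWeight_eq hmd hw', hch, mul_pow, mul_pow,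
        show 2 * d - (d + m').toNat = (d - m').toNat by omega]
      ring
  rw [h, ← add_pow, pow_mul]
  congr 1
  have h1 : √(1 + wCos w) ^ 2 = 1 + wCos w := Real.sq_sqrt (by linarith [wCos_pos hw])
  have h2 : √(1 - wCos w) ^ 2 = 1 - wCos w := Real.sq_sqrt (by linarith [wCos_lt_one hw])
  have h1' : √(1 + wCos w') ^ 2 = 1 + wCos w' := Real.sq_sqrt (by linarith [wCos_pos hw'])
  have h2' : √(1 - wCos w') ^ 2 = 1 - wCos w' := Real.sq_sqrt (by linarith [wCos_lt_one hw'])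
  rw [wSin_eq_sqrt_mul_sqrt hw, wSin_eq_sqrt_mul_sqrt hw', add_sq, mul_pow, mul_pow, h1, h2,
    h1', h2']
  ring

theorem sum_Wstar_mul {d : ℕ} (hd : 2 ≤ d) {r r' : ℂ} (hr : r.re = 0) (hr' : r'.re = 0)
    {y₁ y₂ : ℝ} (hy₁ : 0 < y₁) (hy₂ : 0 < y₂) :
    ∑ m' ∈ Finset.Icc (-(d : ℤ)) (d : ℤ), Wstar d r y₁ y₂ m' * Wstar d r' y₁ y₂ m' =
      (((2 : ℂ) ^ (d + 1) * (π : ℂ))⁻¹) ^ 2 *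
        ∫ p in Set.Ioi (0 : ℝ) ×ˢ Set.Ioi (0 : ℝ),
          ((2 * (1 + wCos p.1 * wCos p.2 + wSin p.1 * wSin p.2) : ℝ) : ℂ) ^ d *
            (whittakerKernel d r y₁ y₂ p.1 * whittakerKernel d r' y₁ y₂ p.2) := by
  have hm : ∀ m' ∈ Finset.Icc (-(d : ℤ)) (d : ℤ), m'.natAbs ≤ d := fun m' h => by
    rw [Finset.mem_Icc] at h
    omega
  have hsum : ∀ p ∈ Set.Ioi (0 : ℝ) ×ˢ Set.Ioi (0 : ℝ),
      ((2 * (1 + wCos p.1 * wCos p.2 + wSin p.1 * wSin p.2) : ℝ) : ℂ) ^ d *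
        (whittakerKernel d r y₁ y₂ p.1 * whittakerKernel d r' y₁ y₂ p.2) =
      ∑ m' ∈ Finset.Icc (-(d : ℤ)) (d : ℤ), ((2 * d).choose (d + m'.natAbs) : ℂ) *
        (((whittakerWeight d m' p.1 : ℂ) * whittakerKernel d r y₁ y₂ p.1) *
          ((whittakerWeight d m' p.2 : ℂ) * whittakerKernel d r' y₁ y₂ p.2)) := by
    rintro ⟨a, z⟩ ⟨ha, hz⟩
    simp only [Set.mem_Ioi] at ha hz
    rw [← ofReal_pow, ← sum_choose_mul_whittakerWeight d ha hz, ofReal_sum, Finset.sum_mul]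
    refine Finset.sum_congr rfl fun m' _ => ?_
    push_cast
    ring
  rw [setIntegral_congr_fun (measurableSet_Ioi.prod measurableSet_Ioi) hsum,
    integral_finsetSum, Finset.mul_sum]
  · refine Finset.sum_congr rfl fun m' h => ?_
    rw [(Wstar_eq hd hr hy₁ hy₂ (hm m' h)).2, (Wstar_eq hd hr' hy₁ hy₂ (hm m' h)).2,
      integral_const_mul, Measure.volume_eq_prod, setIntegral_prod_mul
        (fun w => (whittakerWeight d m' w : ℂ) * whittakerKernel d r y₁ y₂ w)
        (fun w => (whittakerWeight d m' w : ℂ) * whittakerKernel d r' y₁ y₂ w)]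
    have hs : (√((2 * d).choose (d + m'.natAbs)) : ℂ) * (√((2 * d).choose (d + m'.natAbs)) : ℂ) =
        ((2 * d).choose (d + m'.natAbs) : ℂ) := by
      rw [← ofReal_mul, Real.mul_self_sqrt (by positivity), ofReal_natCast]
    rw [← hs]
    ring
  · intro m' h
    refine Integrable.const_mul ?_ _
    rw [Measure.volume_eq_prod, ← Measure.prod_restrict]
    exact (Wstar_eq hd hr hy₁ hy₂ (hm m' h)).1.mul_prod (Wstar_eq hd hr' hy₁ hy₂ (hm m' h)).1

/-- The integrand of `Psi` after the Whittaker functions have been written as integrals. -/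
noncomputable def psiIntegrand (d : ℕ) (r r' t : ℂ) (y p : ℝ × ℝ) : ℂ :=
  ((2 * (1 + wCos p.1 * wCos p.2 + wSin p.1 * wSin p.2) : ℝ) : ℂ) ^ d *
      (whittakerKernel d r y.1 y.2 p.1 * whittakerKernel d r' y.1 y.2 p.2) *
    (((y.1 ^ 2 * y.2 : ℝ) : ℂ) ^ t / ((y.1 * y.2 : ℝ) : ℂ) ^ 3)

/-- The factor of `quadrantKernel` that does not depend on `t`. -/
noncomputable def quadrantWeight (d : ℕ) (r r' : ℂ) (p : ℝ × ℝ) : ℂ :=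
  ((2 * (1 + wCos p.1 * wCos p.2 + wSin p.1 * wSin p.2) : ℝ) : ℂ) ^ d *
    ((wSin p.1 : ℂ) ^ (1 + 2 * r) * (wCos p.1 : ℂ) ^ (1 - 2 * r) * (p.1 : ℂ)⁻¹ *
      (wSin p.1 : ℂ) ^ (-(((d : ℂ) - 1) / 2 + 1 - r)) *
      (wCos p.1 : ℂ) ^ (-(((d : ℂ) - 1) / 2 + 1 + r))) *
    ((wSin p.2 : ℂ) ^ (1 + 2 * r') * (wCos p.2 : ℂ) ^ (1 - 2 * r') * (p.2 : ℂ)⁻¹ *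
      (wSin p.2 : ℂ) ^ (-(((d : ℂ) - 1) / 2 + 1 - r')) *
      (wCos p.2 : ℂ) ^ (-(((d : ℂ) - 1) / 2 + 1 + r')))

theorem psiIntegrand_eq (d : ℕ) (r r' t : ℂ) {y p : ℝ × ℝ}
    (hy : y ∈ Set.Ioi (0 : ℝ) ×ˢ Set.Ioi (0 : ℝ)) (hp : p ∈ Set.Ioi (0 : ℝ) ×ˢ Set.Ioi (0 : ℝ)) :
    psiIntegrand d r r' t y p = quadrantWeight d r r' p * ((2 * π : ℝ) : ℂ) ^ (2 * ((d : ℂ) + 1)) *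
      (((y.1 : ℂ) ^ ((d : ℂ) - 1 + 2 * t - r - r' - 1) *
          cexp (-((2 * π * ((wSin p.1)⁻¹ + (wSin p.2)⁻¹) : ℝ) * y.1))) *
        ((y.2 : ℂ) ^ ((d : ℂ) - 1 + t + r + r' - 1) *
          cexp (-((2 * π * ((wCos p.1)⁻¹ + (wCos p.2)⁻¹) : ℝ) * y.2)))) := by
  obtain ⟨y₁, y₂⟩ := y
  obtain ⟨a, z⟩ := p
  obtain ⟨hy₁, hy₂⟩ := hy
  obtain ⟨ha, hz⟩ := hp
  simp only [Set.mem_Ioi] at ha hz hy₁ hy₂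
  have hp2 : 0 < 2 * π := by positivity
  have sa := wSin_pos ha
  have sz := wSin_pos hz
  have ca := wCos_pos ha
  have cz := wCos_pos hz
  have lq : ∀ {y s : ℝ}, 0 < y → 0 < s → Real.log (2 * π * y / s) =
      Real.log (2 * π) + Real.log y - Real.log s := fun hy hs => by
    rw [Real.log_div (by positivity) hs.ne', Real.log_mul hp2.ne' hy.ne']
  have cube : ((y₁ * y₂ : ℝ) : ℂ) ^ 3 = cexp (3 * (Real.log y₁ + Real.log y₂)) := by
    have : (0 : ℝ) < y₁ * y₂ := by positivity
    rw [← Complex.cpow_ofNat, ofReal_cpow_eq_cexp this, Real.log_mul hy₁.ne' hy₂.ne']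
    push_cast
    ring_nf
  have l2 : Real.log (y₁ ^ 2 * y₂) = 2 * Real.log y₁ + Real.log y₂ := by
    rw [Real.log_mul (by positivity) hy₂.ne', Real.log_pow]
    norm_num
  simp only [psiIntegrand, quadrantWeight, whittakerKernel, whittakerExp]
  rw [cube]
  have e1 : (0 : ℝ) < y₁ ^ 2 * y₂ := by positivity
  simp only [ofReal_cpow_eq_cexp e1, l2, ofReal_cpow_eq_cexp hp2,
    ofReal_cpow_eq_cexp (show 0 < 2 * π * y₁ / wSin a by positivity),
    ofReal_cpow_eq_cexp (show 0 < 2 * π * y₁ / wSin z by positivity),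
    ofReal_cpow_eq_cexp (show 0 < 2 * π * y₂ / wCos a by positivity),
    ofReal_cpow_eq_cexp (show 0 < 2 * π * y₂ / wCos z by positivity), lq hy₁ sa, lq hy₁ sz,
    lq hy₂ ca, lq hy₂ cz,
    ofReal_cpow_eq_cexp sa, ofReal_cpow_eq_cexp sz, ofReal_cpow_eq_cexp ca,
    ofReal_cpow_eq_cexp cz, ofReal_cpow_eq_cexp hy₁, ofReal_cpow_eq_cexp hy₂]
  rw [← Complex.exp_sub]
  have comb : ∀ (M A Z x1 x2 x3 x4 x5 x6 x7 x8 x9 x10 x11 x12 x13 : ℂ),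
      M * ((cexp x1 * cexp x2 * A * (cexp x3 * cexp x4 * (cexp x5 * cexp x6))) *
        (cexp x7 * cexp x8 * Z * (cexp x9 * cexp x10 * (cexp x11 * cexp x12)))) *
        cexp x13 =
      M * A * Z * cexp (x1 + x2 + x3 + x4 + x5 + x6 + x7 + x8 + x9 + x10 + x11 + x12 + x13) := by
    intros
    simp only [Complex.exp_add]
    ring
  have comb' : ∀ (M A Z x1 x2 x3 x4 x5 x6 x7 x8 x9 x10 x11 x12 x13 : ℂ),
      M * (cexp x1 * cexp x2 * A * cexp x3 * cexp x4) *
        (cexp x5 * cexp x6 * Z * cexp x7 * cexp x8) * cexp x9 *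
        ((cexp x10 * cexp x11) * (cexp x12 * cexp x13)) =
      M * A * Z * cexp (x1 + x2 + x3 + x4 + x5 + x6 + x7 + x8 + x9 + x10 + x11 + x12 + x13) := by
    intros
    simp only [Complex.exp_add]
    ring
  rw [comb, comb']
  congr 2
  push_cast
  simp only [div_eq_mul_inv]
  ring

theorem integral_psiIntegrand_right {d : ℕ} {r r' t : ℂ} (hP : 0 < ((d : ℂ) - 1 + 2 * t - r - r').re)
    (hQ : 0 < ((d : ℂ) - 1 + t + r + r').re) {p : ℝ × ℝ}
    (hp : p ∈ Set.Ioi (0 : ℝ) ×ˢ Set.Ioi (0 : ℝ)) :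
    IntegrableOn (fun y => psiIntegrand d r r' t y p) (Set.Ioi (0 : ℝ) ×ˢ Set.Ioi (0 : ℝ)) ∧
    ∫ y in Set.Ioi (0 : ℝ) ×ˢ Set.Ioi (0 : ℝ), psiIntegrand d r r' t y p =
      ((2 * π : ℝ) : ℂ) ^ (4 - 3 * t) * (Complex.Gamma ((d : ℂ) - 1 + 2 * t - r - r') *
        Complex.Gamma ((d : ℂ) - 1 + t + r + r')) * quadrantKernel d r r' t p := by
  have hms : MeasurableSet (Set.Ioi (0 : ℝ) ×ˢ Set.Ioi (0 : ℝ)) :=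
    measurableSet_Ioi.prod measurableSet_Ioi
  have hexp : ∀ {a : ℂ} {s : ℝ}, 0 < a.re → 0 < s →
      IntegrableOn (fun y : ℝ => (y : ℂ) ^ (a - 1) * cexp (-(s * y))) (Set.Ioi 0) := by
    intro a s ha hs
    have h := (integrableOn_Ioi_comp_mul_left_iff _ 0 hs).2
      (by simpa using Complex.GammaIntegral_convergent ha)
    refine IntegrableOn.congr_fun (h.const_mul ((s : ℂ) ^ (-(a - 1)))) (fun y hy => ?_)
      measurableSet_Ioi
    have hy : 0 < y := hy
    have hs' : (s : ℂ) ^ (-(a - 1)) * (s : ℂ) ^ (a - 1) = 1 := by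
      rw [← Complex.cpow_add _ _ (by exact_mod_cast hs.ne'), neg_add_cancel, cpow_zero]
    rw [ofReal_mul, Complex.mul_cpow_ofReal_nonneg hs.le hy.le]
    linear_combination ((y : ℂ) ^ (a - 1) * cexp (-(s * y))) * hs'
  have hσ : 0 < (wSin p.1)⁻¹ + (wSin p.2)⁻¹ :=
    add_pos (inv_pos.2 (wSin_pos hp.1)) (inv_pos.2 (wSin_pos hp.2))
  have hκ : 0 < (wCos p.1)⁻¹ + (wCos p.2)⁻¹ :=
    add_pos (inv_pos.2 (wCos_pos hp.1)) (inv_pos.2 (wCos_pos hp.2))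
  have hpi : 0 < 2 * π := by positivity
  have heq := fun y hy => psiIntegrand_eq d r r' t (y := y) hy hp
  have hpow : ∀ {s : ℝ} {a : ℂ}, 0 < s → (1 / ((2 * π * s : ℝ) : ℂ)) ^ a =
      ((2 * π : ℝ) : ℂ) ^ (-a) * (s : ℂ) ^ (-a) := by
    intro s a hs
    rw [show 1 / ((2 * π * s : ℝ) : ℂ) = (((2 * π * s)⁻¹ : ℝ) : ℂ) by push_cast; rw [one_div],
      ofReal_cpow_eq_cexp (by positivity), ofReal_cpow_eq_cexp hs, ofReal_cpow_eq_cexp hpi,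
      ← Complex.exp_add, Real.log_inv, Real.log_mul hpi.ne' hs.ne']
    push_cast
    ring_nf
  constructor
  · refine IntegrableOn.congr_fun (Integrable.const_mul ?_ _) (fun y hy => (heq y hy).symm) hms
    rw [Measure.volume_eq_prod, ← Measure.prod_restrict]
    exact (hexp hP (mul_pos hpi hσ)).mul_prod (hexp hQ (mul_pos hpi hκ))
  · rw [setIntegral_congr_fun hms heq, integral_const_mul, Measure.volume_eq_prod,
      setIntegral_prod_mul
        (fun y : ℝ => (y : ℂ) ^ ((d : ℂ) - 1 + 2 * t - r - r' - 1) *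
          cexp (-((2 * π * ((wSin p.1)⁻¹ + (wSin p.2)⁻¹) : ℝ) * y)))
        (fun y : ℝ => (y : ℂ) ^ ((d : ℂ) - 1 + t + r + r' - 1) *
          cexp (-((2 * π * ((wCos p.1)⁻¹ + (wCos p.2)⁻¹) : ℝ) * y))),
      Complex.integral_cpow_mul_exp_neg_mul_Ioi hP (mul_pos hpi hσ),
      Complex.integral_cpow_mul_exp_neg_mul_Ioi hQ (mul_pos hpi hκ),
      hpow hσ, hpow hκ]
    have h2 : ((2 * π : ℝ) : ℂ) ^ (2 * ((d : ℂ) + 1)) *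
        (((2 * π : ℝ) : ℂ) ^ (-((d : ℂ) - 1 + 2 * t - r - r')) *
        ((2 * π : ℝ) : ℂ) ^ (-((d : ℂ) - 1 + t + r + r'))) = ((2 * π : ℝ) : ℂ) ^ (4 - 3 * t) := by
      have : ((2 * π : ℝ) : ℂ) ≠ 0 := by exact_mod_cast hpi.ne'
      rw [← Complex.cpow_add _ _ this, ← Complex.cpow_add _ _ this]
      ring_nf
    have hq : quadrantKernel d r r' t p = quadrantWeight d r r' p *
        (((wSin p.1)⁻¹ + (wSin p.2)⁻¹ : ℝ) : ℂ) ^ (-((d : ℂ) - 1 + 2 * t - r - r')) *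
        (((wCos p.1)⁻¹ + (wCos p.2)⁻¹ : ℝ) : ℂ) ^ (-((d : ℂ) - 1 + t + r + r')) := rfl
    rw [← h2, hq]
    ring

theorem coe_norm_whittakerKernel (d : ℕ) {r : ℂ} (hr : r.re = 0) {y₁ y₂ w : ℝ} (hy₁ : 0 < y₁)
    (hy₂ : 0 < y₂) (hw : 0 < w) :
    ((‖whittakerKernel d r y₁ y₂ w‖ : ℝ) : ℂ) = whittakerKernel d 0 y₁ y₂ w := by
  have hs := wSin_pos hw
  have hc := wCos_pos hw
  have hn : ∀ {x : ℝ} (z : ℂ), 0 < x → ((‖(x : ℂ) ^ z‖ : ℝ) : ℂ) = (x : ℂ) ^ (z.re : ℂ) :=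
    fun z hx => by rw [norm_cpow_eq_rpow_re_of_pos hx, ofReal_cpow hx.le]
  have he : ∀ x : ℝ, ((‖cexp (-(x : ℂ))‖ : ℝ) : ℂ) = cexp (-(x : ℂ)) := fun x => by
    rw [Complex.norm_exp, ofReal_exp, neg_re, ofReal_re, ofReal_neg]
  simp only [whittakerKernel, whittakerExp, norm_mul, ofReal_mul, hn _ hs, hn _ hc, he, norm_inv,
    Complex.norm_of_nonneg hw.le, ofReal_inv,
    hn _ (show 0 < 2 * π * y₁ / wSin w by positivity),
    hn _ (show 0 < 2 * π * y₂ / wCos w by positivity)]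
  simp [hr]

theorem coe_norm_psiIntegrand (d : ℕ) {r r' : ℂ} (hr : r.re = 0) (hr' : r'.re = 0) (t : ℝ)
    {y p : ℝ × ℝ} (hy : y ∈ Set.Ioi (0 : ℝ) ×ˢ Set.Ioi (0 : ℝ))
    (hp : p ∈ Set.Ioi (0 : ℝ) ×ˢ Set.Ioi (0 : ℝ)) :
    ((‖psiIntegrand d r r' t y p‖ : ℝ) : ℂ) = psiIntegrand d 0 0 t y p := by
  have h1 := wSin_pos hp.1
  have h2 := wSin_pos hp.2
  have h3 := wCos_pos hp.1
  have h4 := wCos_pos hp.2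
  have hy₁ : 0 < y.1 := hy.1
  have hy₂ : 0 < y.2 := hy.2
  have e1 : 0 < y.1 ^ 2 * y.2 := by positivity
  have e2 : 0 < y.1 * y.2 := by positivity
  rw [psiIntegrand, psiIntegrand, norm_mul, norm_mul, norm_mul, norm_div, norm_pow, norm_pow,
    norm_cpow_eq_rpow_re_of_pos e1, Complex.norm_of_nonneg e2.le,
    Complex.norm_of_nonneg (by positivity), ofReal_re]
  rw [ofReal_mul, ofReal_mul, ofReal_mul, ofReal_div, ofReal_pow, ofReal_pow,
    ofReal_cpow e1.le, coe_norm_whittakerKernel d hr hy.1 hy.2 hp.1,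
    coe_norm_whittakerKernel d hr' hy.1 hy.2 hp.2]

theorem measurable_psiIntegrand (d : ℕ) (r r' t : ℂ) :
    Measurable (Function.uncurry (psiIntegrand d r r' t)) := by
  unfold Function.uncurry psiIntegrand whittakerKernel whittakerExp
  fun_prop

theorem Psi_eq_integral_quadrantKernel {d : ℕ} (hd : 2 ≤ d) {r r' : ℂ} (hr : r.re = 0)
    (hr' : r'.re = 0) {t : ℝ} (ht : 0 < t) :
    Psi d r r' t = (((2 : ℂ) ^ (d + 1) * (π : ℂ))⁻¹) ^ 2 * (((2 * π : ℝ) : ℂ) ^ (4 - 3 * (t : ℂ)) *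
      (Complex.Gamma ((d : ℂ) - 1 + 2 * t - r - r') *
        Complex.Gamma ((d : ℂ) - 1 + t + r + r')) *
      ∫ p in Set.Ioi (0 : ℝ) ×ˢ Set.Ioi (0 : ℝ), quadrantKernel d r r' t p) := by
  have hd' : (2 : ℝ) ≤ d := by exact_mod_cast hd
  have hms : MeasurableSet (Set.Ioi (0 : ℝ) ×ˢ Set.Ioi (0 : ℝ)) :=
    measurableSet_Ioi.prod measurableSet_Ioi
  have hre : ∀ {r r' : ℂ}, r.re = 0 → r'.re = 0 → 0 < ((d : ℂ) - 1 + 2 * t - r - r').re ∧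
      0 < ((d : ℂ) - 1 + t + r + r').re := fun h h' => by
    simp only [add_re, sub_re, mul_re, natCast_re, one_re, h, h', ofReal_re, re_ofNat, im_ofNat]
    constructor <;> linarith
  set ν := (volume : Measure (ℝ × ℝ)).restrict (Set.Ioi (0 : ℝ) ×ˢ Set.Ioi (0 : ℝ)) with hν
  have hright := fun p hp => integral_psiIntegrand_right (d := d) (r := r) (r' := r') (t := t)
    (hre hr hr').1 (hre hr hr').2 (p := p) hp
  have hInt : Integrable (Function.uncurry (psiIntegrand d r r' t)) (ν.prod ν) := by
    rw [integrable_prod_iff' (measurable_psiIntegrand d r r' t).aestronglyMeasurable]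
    refine ⟨(ae_restrict_iff' hms).2 (Filter.Eventually.of_forall fun p hp => (hright p hp).1), ?_⟩
    have h0 := fun p hp => (integral_psiIntegrand_right (d := d) (r := 0) (r' := 0) (t := t)
      (hre zero_re zero_re).1 (hre zero_re zero_re).2 (p := p) hp).2
    have hker : IntegrableOn (quadrantKernel d 0 0 t) (Set.Ioi (0 : ℝ) ×ˢ Set.Ioi (0 : ℝ)) := by
      refine (integral_quadrantKernel d ?_ ?_ ?_ ?_).1 <;> simp <;> linarith
    have hnorm : IntegrableOn (fun p => ((∫ y, ‖psiIntegrand d r r' t y p‖ ∂ν : ℝ) : ℂ))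
        (Set.Ioi (0 : ℝ) ×ˢ Set.Ioi (0 : ℝ)) := by
      refine IntegrableOn.congr_fun (hker.const_mul _) (fun p hp => ((h0 p hp).symm.trans ?_)) hms
      rw [← integral_complex_ofReal]
      exact setIntegral_congr_fun hms fun y hy => (coe_norm_psiIntegrand d hr hr' t hy hp).symm
    simpa using hnorm.re
  have hleft : Integrable (fun y => ∫ p, psiIntegrand d r r' t y p ∂ν) ν :=
    hInt.integral_prod_left
  have hinner : ∀ y₁ ∈ Set.Ioi (0 : ℝ), ∀ y₂ ∈ Set.Ioi (0 : ℝ),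
      (∑ m' ∈ Finset.Icc (-(d : ℤ)) (d : ℤ), Wstar d r y₁ y₂ m' * Wstar d r' y₁ y₂ m') *
        ((y₁ ^ 2 * y₂ : ℝ) : ℂ) ^ (t : ℂ) / ((y₁ * y₂ : ℝ) : ℂ) ^ 3 =
      (((2 : ℂ) ^ (d + 1) * (π : ℂ))⁻¹) ^ 2 * ∫ p, psiIntegrand d r r' t (y₁, y₂) p ∂ν := by
    intro y₁ hy₁ y₂ hy₂
    rw [sum_Wstar_mul hd hr hr' hy₁ hy₂, mul_div_assoc, mul_assoc, ← integral_mul_const]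
    rfl
  rw [Psi, setIntegral_congr_fun measurableSet_Ioi fun y₁ hy₁ =>
    setIntegral_congr_fun measurableSet_Ioi (hinner y₁ hy₁)]
  have hprod := setIntegral_prod (μ := (volume : Measure ℝ)) (ν := (volume : Measure ℝ))
    (fun y : ℝ × ℝ => (((2 : ℂ) ^ (d + 1) * (π : ℂ))⁻¹) ^ 2 * ∫ p, psiIntegrand d r r' t y p ∂ν)
    (hleft.const_mul _)
  rw [← hprod, ← Measure.volume_eq_prod, integral_const_mul]
  congr 1
  rw [integral_integral_swap hInt, ← integral_const_mul]
  exact setIntegral_congr_fun hms fun p hp => (hright p hp).2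

theorem integral_Ioo_beta_add_swap {a b : ℂ} (ha : 0 < a.re) (hb : 0 < b.re) :
    (∫ x in Set.Ioo (0 : ℝ) 1, (x : ℂ) ^ (a - 1) * ((1 + x : ℝ) : ℂ) ^ (-(a + b))) +
      ∫ x in Set.Ioo (0 : ℝ) 1, (x : ℂ) ^ (b - 1) * ((1 + x : ℝ) : ℂ) ^ (-(a + b)) =
    Complex.Gamma a * Complex.Gamma b / Complex.Gamma (a + b) := by
  obtain ⟨hInt, heq⟩ := integral_Ioi_beta ha hb
  have hinv : ∫ x in Set.Ioi (1 : ℝ), (x : ℂ) ^ (a - 1) * ((1 + x : ℝ) : ℂ) ^ (-(a + b)) =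
      ∫ x in Set.Ioo (0 : ℝ) 1, (x : ℂ) ^ (b - 1) * ((1 + x : ℝ) : ℂ) ^ (-(a + b)) := by
    have himg : (fun x : ℝ => x⁻¹) '' Set.Ioo 0 1 = Set.Ioi 1 := by
      rw [Set.image_inv_eq_inv, Set.inv_Ioo_0_left one_pos, inv_one]
    rw [← himg, integral_image_eq_integral_abs_deriv_smul measurableSet_Ioo
      (fun x hx => (hasDerivAt_inv hx.1.ne').hasDerivWithinAt) inv_injective.injOn]
    refine setIntegral_congr_fun measurableSet_Ioo fun x hx => ?_
    have hx0 : 0 < x := hx.1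
    have h1 : 0 < 1 + x := by positivity
    have habs : |-(x ^ 2)⁻¹| = (x ^ 2)⁻¹ := by rw [abs_neg, abs_of_pos (by positivity)]
    have hsq : (((x ^ 2)⁻¹ : ℝ) : ℂ) = cexp (-2 * Real.log x) := by
      rw [show (x ^ 2)⁻¹ = Real.exp (-2 * Real.log x) by
        rw [neg_mul, Real.exp_neg, two_mul, Real.exp_add, Real.exp_log hx0, sq]]
      push_cast
      rfl
    rw [habs, Complex.real_smul, hsq, show 1 + x⁻¹ = (1 + x) / x by field_simp; ring,
      ofReal_cpow_eq_cexp (inv_pos.2 hx0), ofReal_cpow_eq_cexp (div_pos h1 hx0),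
      ofReal_cpow_eq_cexp hx0, ofReal_cpow_eq_cexp h1, Real.log_inv,
      Real.log_div h1.ne' hx0.ne', ← Complex.exp_add, ← Complex.exp_add, ← Complex.exp_add]
    congr 1
    push_cast
    ring
  rw [← heq, ← Set.Ioc_union_Ioi_eq_Ioi zero_le_one,
    setIntegral_union (Set.Ioc_disjoint_Ioi le_rfl) measurableSet_Ioi
      (hInt.mono_set Set.Ioc_subset_Ioi_self) (hInt.mono_set (Set.Ioi_subset_Ioi zero_le_one)),
    hinv, integral_Ioc_eq_integral_Ioo]

theorem MellinBarnes_term_eq_integral_Ioo {δ c : ℝ} {D q B p₁ p₂ C A A' : ℂ} (hδ : 0 < δ)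
    (hc : 1 < c) (hc2 : c ≤ 2) (hcC : C = c) (hD : δ < D.re) (hqδ : δ < q.re)
    (hB : 2 * δ < B.re) (hp₁ : 0 < p₁.re) (hA : 3 * δ < A.re) (hp₂ : 0 < p₂.re)
    (hq : q = p₁ + p₂) (hCq : C = 2 - q) (hA₁ : A = B + p₁) (hA₂ : A' = A + p₂)
    {T : ℝ × ℝ × ℝ → ℂ} (hT : ∀ u, T u =
      Complex.Gamma (δ + I * u.1) * Complex.Gamma (δ + I * u.2.1) * Complex.Gamma (δ + I * u.2.2) *
        Complex.Gamma (D - (δ + I * u.2.1)) * Complex.Gamma (q - (δ + I * u.2.2)) *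
        (Complex.Gamma (C + (δ + I * u.1)))⁻¹ *
      (Complex.Gamma (B - (δ + I * u.1) - (δ + I * u.2.1)) *
        Complex.Gamma (A - (δ + I * u.1) - (δ + I * u.2.1) - (δ + I * u.2.2)) /
      (Complex.Gamma (A - (δ + I * u.1) - (δ + I * u.2.1)) *
        Complex.Gamma (A' - (δ + I * u.1) - (δ + I * u.2.1) - (δ + I * u.2.2))))) :
    Integrable T ∧ ∫ u, T u = (2 * π) ^ 3 * (Complex.Gamma D / Complex.Gamma C) * 2 ^ (-p₁) *
      ∫ a in Set.Ioo (0 : ℝ) 1, (a : ℂ) ^ (B - 1) * ((1 + a : ℝ) : ℂ) ^ (-(D + p₂)) := by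
  have hT' := fun u => (hT u).trans (?_ : _ =
    Complex.Gamma (δ + I * u.1) / Complex.Gamma (δ + I * u.1 + c) *
      ((Complex.Gamma (δ + I * u.2.1) * Complex.Gamma (D - (δ + I * u.2.1))) *
        (Complex.Gamma (δ + I * u.2.2) * Complex.Gamma (q - (δ + I * u.2.2)))) *
      (Complex.Gamma (B - (δ + I * u.1) - (δ + I * u.2.1)) /
        Complex.Gamma (B - (δ + I * u.1) - (δ + I * u.2.1) + p₁) *
      (Complex.Gamma (A - (δ + I * u.1) - (δ + I * u.2.1) - (δ + I * u.2.2)) /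
        Complex.Gamma (A - (δ + I * u.1) - (δ + I * u.2.1) - (δ + I * u.2.2) + p₂))))
  · obtain ⟨hInt, heq⟩ := MellinBarnes_term hδ hc hc2 hD hqδ hB hp₁ hA hp₂ hT'
    refine ⟨hInt, heq.trans ?_⟩
    have h := integral_unitSquare (B := B) (D := D) hq hCq
    rw [← hcC, hA₁, h, (integral_Ioi_beta hp₁ hp₂).2, ← hq]
    have h1 := Complex.Gamma_ne_zero_of_re_pos hp₁
    have h2 := Complex.Gamma_ne_zero_of_re_pos hp₂
    have h3 := Complex.Gamma_ne_zero_of_re_pos (hδ.trans hqδ)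
    field_simp
  · rw [show C + (δ + I * u.1) = δ + I * u.1 + c by rw [hcC]; ring,
      show B - (δ + I * u.1) - (δ + I * u.2.1) + p₁ = A - (δ + I * u.1) - (δ + I * u.2.1) by
        rw [hA₁]; ring,
      show A - (δ + I * u.1) - (δ + I * u.2.1) - (δ + I * u.2.2) + p₂ =
        A' - (δ + I * u.1) - (δ + I * u.2.1) - (δ + I * u.2.2) by rw [hA₂]; ring]
    simp only [div_eq_mul_inv, mul_inv]
    ring

/-- The three-dimensional Mellin-Barnes integral representation of `Ψ^d(r, r', t)`, with the
three contours placed at real part `δ ∈ (0, t/4)`. -/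
theorem Psi_eq_MellinBarnes (d : ℕ) (hd : 2 ≤ d) (r r' : ℂ) (hr : r.re = 0) (hr' : r'.re = 0)
    (t : ℝ) (ht0 : 0 < t) (ht1 : t < 2 / 3) (δ : ℝ) (hδ0 : 0 < δ) (hδ1 : δ < t / 4) :
    Psi d r r' (t : ℂ) =
      (((2 * Real.pi : ℝ) : ℂ)) ^ (4 - 3 * (t : ℂ)) / ((2 : ℂ) ^ d * (Real.pi : ℂ) ^ 2) *
        (Complex.Gamma ((d : ℂ) - 1 + 2 * (t : ℂ) - r - r') *
          Complex.Gamma ((d : ℂ) - 1 + (t : ℂ) + r + r') *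
            Complex.Gamma (2 - 3 * (t : ℂ) / 2) * Complex.Gamma ((t : ℂ) / 2 - r - r') *
              Complex.Gamma ((t : ℂ) + r + r') /
          (Complex.Gamma ((d : ℂ) - 1 + 3 * (t : ℂ) / 2) * Complex.Gamma (3 * (t : ℂ) / 2))) *
        ((((2 * Real.pi : ℝ) : ℂ))⁻¹ ^ 3 *
          ∫ u : ℝ × ℝ × ℝ,
            (fun s₁ s₂ s₃ : ℂ =>
              Complex.Gamma s₁ * Complex.Gamma s₂ * Complex.Gamma s₃ *
                Complex.Gamma ((d : ℂ) - 1 + 3 * (t : ℂ) / 2 - s₂) *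
                  Complex.Gamma (3 * (t : ℂ) / 2 - s₃) *
                    (Complex.Gamma (2 - 3 * (t : ℂ) / 2 + s₁))⁻¹ *
              (Complex.Gamma (((d : ℂ) - 1) / 2 + (t : ℂ) + r - 2 * r' - s₁ - s₂) *
                  Complex.Gamma (((d : ℂ) - 1) / 2 + 2 * (t : ℂ) + 2 * r - r' - s₁ - s₂ - s₃) /
                (Complex.Gamma (((d : ℂ) - 1) / 2 + 2 * (t : ℂ) + 2 * r - r' - s₁ - s₂) *
                  Complex.Gamma (((d : ℂ) - 1 + 5 * (t : ℂ)) / 2 + r - 2 * r' - s₁ - s₂ - s₃)) +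
               Complex.Gamma (((d : ℂ) - 1) / 2 + (t : ℂ) + r' - 2 * r - s₁ - s₂) *
                  Complex.Gamma (((d : ℂ) - 1) / 2 + 2 * (t : ℂ) + 2 * r' - r - s₁ - s₂ - s₃) /
                (Complex.Gamma (((d : ℂ) - 1) / 2 + 2 * (t : ℂ) + 2 * r' - r - s₁ - s₂) *
                  Complex.Gamma (((d : ℂ) - 1 + 5 * (t : ℂ)) / 2 + r' - 2 * r - s₁ - s₂ - s₃))))
            ((δ : ℂ) + Complex.I * u.1) ((δ : ℂ) + Complex.I * u.2.1)
            ((δ : ℂ) + Complex.I * u.2.2)) := by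
  have hd' : (2 : ℝ) ≤ d := by exact_mod_cast hd
  have hdre : (((d : ℂ) - 1) / 2).re = ((d : ℝ) - 1) / 2 := by simp
  have hterm : ∀ {r r' : ℂ}, r.re = 0 → r'.re = 0 → _ := fun {r r'} hr hr' =>
    MellinBarnes_term_eq_integral_Ioo (δ := δ) (c := 2 - 3 * t / 2) (D := (d : ℂ) - 1 + 3 * t / 2)
    (q := 3 * t / 2) (B := ((d : ℂ) - 1) / 2 + t + r - 2 * r') (p₁ := t + r + r')
    (p₂ := t / 2 - r - r') (C := 2 - 3 * t / 2) (A := ((d : ℂ) - 1) / 2 + 2 * t + 2 * r - r')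
    (A' := ((d : ℂ) - 1 + 5 * t) / 2 + r - 2 * r') hδ0 (by linarith) (by linarith)
    (by push_cast; ring) (by simp; linarith) (by simp; linarith)
    (by simp only [add_re, sub_re, hdre]; simp [hr, hr']; linarith)
    (by simpa [hr, hr'] using ht0)
    (by simp only [add_re, sub_re, hdre]; simp [hr, hr']; linarith)
    (by simp [hr, hr']; linarith) (by ring) (by ring) (by ring) (by ring)
    (T := _) (fun u => rfl)
  obtain ⟨hi₁, he₁⟩ := hterm hr hr'
  obtain ⟨hi₂, he₂⟩ := hterm hr' hr
  have hB : 0 < (((d : ℂ) - 1) / 2 + t - 2 * r + r').re := by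
    simp only [add_re, sub_re, hdre]; simp [hr, hr']; linarith
  have hB' : 0 < (((d : ℂ) - 1) / 2 + t - 2 * r' + r).re := by
    simp only [add_re, sub_re, hdre]; simp [hr, hr']; linarith
  have h₁ : 0 < ((t : ℂ) + r + r').re := by simpa [hr, hr'] using ht0
  have h₂ : 0 < ((t : ℂ) / 2 - r - r').re := by simpa [hr, hr'] using ht0
  simp only [mul_add]
  rw [integral_add hi₁ hi₂, he₁, he₂, Psi_eq_integral_quadrantKernel hd hr hr' ht0,
    (integral_quadrantKernel d h₁ h₂ hB hB').2]
  have hbeta := integral_Ioo_beta_add_swap hB hB'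
  rw [show ((d : ℂ) - 1) / 2 + t - 2 * r + r' + (((d : ℂ) - 1) / 2 + t - 2 * r' + r) =
    (d : ℂ) - 1 + 2 * t - r - r' by ring] at hbeta
  rw [← hbeta]
  simp only [show (d : ℂ) - 1 + 3 * t / 2 + (t / 2 - r - r') = (d : ℂ) - 1 + 2 * t - r - r' by ring,
    show (d : ℂ) - 1 + 3 * t / 2 + (t / 2 - r' - r) = (d : ℂ) - 1 + 2 * t - r - r' by ring,
    show ((d : ℂ) - 1) / 2 + t + r - 2 * r' = ((d : ℂ) - 1) / 2 + t - 2 * r' + r by ring,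
    show ((d : ℂ) - 1) / 2 + t + r' - 2 * r = ((d : ℂ) - 1) / 2 + t - 2 * r + r' by ring,
    show (t : ℂ) + r' + r = t + r + r' by ring]
  generalize (∫ x in Set.Ioo (0 : ℝ) 1, (x : ℂ) ^ (((d : ℂ) - 1) / 2 + t - 2 * r + r' - 1) *
    ((1 + x : ℝ) : ℂ) ^ (-((d : ℂ) - 1 + 2 * t - r - r'))) = J
  generalize (∫ x in Set.Ioo (0 : ℝ) 1, (x : ℂ) ^ (((d : ℂ) - 1) / 2 + t - 2 * r' + r - 1) *
    ((1 + x : ℝ) : ℂ) ^ (-((d : ℂ) - 1 + 2 * t - r - r'))) = J'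
  have hpow : (2 : ℂ) ^ (2 + (d : ℂ) - t - r - r') = 4 * 2 ^ d * 2 ^ (-((t : ℂ) + r + r')) := by
    rw [show 2 + (d : ℂ) - t - r - r' = ((2 + d : ℕ) : ℂ) + (-(t + r + r')) by push_cast; ring,
      Complex.cpow_add _ _ two_ne_zero, Complex.cpow_natCast, pow_add]
    norm_num
  have hD : Complex.Gamma ((d : ℂ) - 1 + 3 * t / 2) ≠ 0 :=
    Complex.Gamma_ne_zero_of_re_pos (by simp; linarith)
  have hC : Complex.Gamma (2 - 3 * (t : ℂ) / 2) ≠ 0 :=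
    Complex.Gamma_ne_zero_of_re_pos (by simp; linarith)
  have hπ : (π : ℂ) ≠ 0 := by exact_mod_cast pi_ne_zero
  have h2 : ((2 * π : ℝ) : ℂ) = 2 * π := by push_cast; rfl
  have h2π : (2 * π : ℂ) ≠ 0 := mul_ne_zero two_ne_zero hπ
  have hfront : (((2 : ℂ) ^ (d + 1) * (π : ℂ))⁻¹) ^ 2 * (4 * 2 ^ d) = ((2 : ℂ) ^ d * π ^ 2)⁻¹ := by
    field_simp
    ring
  rw [hpow, h2]
  generalize Complex.Gamma ((d : ℂ) - 1 + 3 * t / 2) = GD at hD ⊢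
  generalize Complex.Gamma (2 - 3 * (t : ℂ) / 2) = GC at hC ⊢
  generalize Complex.Gamma (3 * (t : ℂ) / 2) = Gq
  generalize (2 * π : ℂ) ^ (4 - 3 * (t : ℂ)) = X
  generalize (2 : ℂ) ^ (-((t : ℂ) + r + r')) = Y
  generalize ((2 : ℂ) ^ (d + 1) * (π : ℂ))⁻¹ ^ 2 = Z at hfront ⊢
  have hrhs : ∀ a b c f e : ℂ, a * (b * GC * c * f / (GD * e)) * ((2 * π : ℂ)⁻¹ ^ 3 *
      ((2 * π) ^ 3 * (GD / GC) * Y * J' + (2 * π) ^ 3 * (GD / GC) * Y * J)) =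
      a * (b * c * f / e) * (Y * (J + J')) := by
    intro a b c f e
    rcases eq_or_ne e 0 with rfl | he
    · simp
    · field_simp
      ring
  rw [hrhs, div_eq_mul_inv X]
  linear_combination X * Complex.Gamma ((d : ℂ) - 1 + 2 * t - r - r') *
    Complex.Gamma ((d : ℂ) - 1 + t + r + r') * Y * (J + J') *
    (Complex.Gamma (t + r + r') * Complex.Gamma (t / 2 - r - r') / Gq) * hfront
end

section
/- Let m ≥ 0 be an integer, ε ∈ {1,−1}, and a ∈ ℂ with a ∉ ℤ. Then ∑_{ℓ=0}^{m} ε^ℓ binom(m,ℓ) Γ((ℓ−a)/2) · Γ((1−m+ℓ)/2)^{−1} = −ε^m · 2^a · Γ((1+a+m)/2) / (Γ(1+a) · sin(π(a−m)/2)). Here, when m−ℓ is odd and ℓ < m, the argument (1−m+ℓ)/2 is a nonpositive integer, a pole of Γ, and the corresponding term is interpreted as 0 (i.e. the reciprocal of Γ at its poles is 0). -/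
open Complex Real Finset

/-- The reciprocal Gamma factor is supported on the indices `ℓ ≤ m` of the same parity as `m`, so
the sign `ε ^ ℓ` can be replaced by `ε ^ m`. -/
lemma sign_pow_mul_inv_Gamma {m ℓ : ℕ} (hℓ : ℓ ≤ m) {ε : ℂ} (hε : ε = 1 ∨ ε = -1) :
    ε ^ ℓ * (Complex.Gamma ((1 - (m : ℂ) + (ℓ : ℂ)) / 2))⁻¹ =
      ε ^ m * (Complex.Gamma ((1 - (m : ℂ) + (ℓ : ℂ)) / 2))⁻¹ := by
  obtain ⟨d, rfl⟩ := Nat.exists_eq_add_of_le hℓ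
  rcases Nat.even_or_odd' d with ⟨k, rfl | rfl⟩
  · have h : ε ^ 2 = 1 := by rcases hε with rfl | rfl <;> norm_num
    rw [pow_add, pow_mul, h, one_pow, mul_one]
  · have h : (1 - ((ℓ + (2 * k + 1) : ℕ) : ℂ) + (ℓ : ℂ)) / 2 = -(k : ℂ) := by
      push_cast; ring
    rw [h, Complex.Gamma_neg_nat_eq_zero, inv_zero, mul_zero, mul_zero]

/-- The sum of `binomial_gamma_sum` without signs. -/
noncomputable def gammaRatioSum (m : ℕ) (a : ℂ) : ℂ :=
  ∑ ℓ ∈ Finset.range (m + 1), (m.choose ℓ : ℂ) * (Complex.Gamma (((ℓ : ℂ) - a) / 2) *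
    (Complex.Gamma ((1 - (m : ℂ) + (ℓ : ℂ)) / 2))⁻¹)

/-- The closed form of `gammaRatioSum`. -/
noncomputable def gammaRatioClosedForm (m : ℕ) (a : ℂ) : ℂ :=
  -(2 : ℂ) ^ a * Complex.Gamma ((1 + a + (m : ℂ)) / 2) /
    (Complex.Gamma (1 + a) * Complex.sin ((Real.pi : ℂ) * (a - (m : ℂ)) / 2))

lemma gammaRatioSum_succ (m : ℕ) (a : ℂ) :
    gammaRatioSum (m + 1) a = ∑ ℓ ∈ Finset.range (m + 1), (m.choose ℓ : ℂ) *
      (Complex.Gamma (((ℓ : ℂ) - a) / 2) * (Complex.Gamma (((ℓ : ℂ) - (m : ℂ)) / 2))⁻¹) +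
        gammaRatioSum m (a - 1) := by
  have h := Finset.sum_choose_succ_mul (R := ℂ) (fun i _ ↦ Complex.Gamma (((i : ℂ) - a) / 2) *
    (Complex.Gamma ((1 - ((m + 1 : ℕ) : ℂ) + (i : ℂ)) / 2))⁻¹) m
  simp only [gammaRatioSum]
  rw [h]
  congr 1 <;>
  · refine Finset.sum_congr rfl fun i _ ↦ ?_
    push_cast
    ring_nf

lemma gammaRatioSum_one (a : ℂ) : gammaRatioSum 1 a = gammaRatioSum 0 (a - 1) := by
  rw [gammaRatioSum_succ]
  simp

lemma gammaRatioSum_add_two (m : ℕ) (a : ℂ) :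
    gammaRatioSum (m + 2) a =
      gammaRatioSum (m + 1) (a - 1) - ((m : ℂ) + 1) / 2 * gammaRatioSum m a := by
  rw [gammaRatioSum_succ, Finset.sum_range_succ, sub_self, zero_div, Complex.Gamma_zero, inv_zero,
    mul_zero, mul_zero, add_zero, add_comm, sub_eq_add_neg (gammaRatioSum _ _),
    add_right_inj, gammaRatioSum,
    Finset.mul_sum, ← Finset.sum_neg_distrib]
  refine Finset.sum_congr rfl fun ℓ hℓ ↦ ?_
  have hle : ℓ ≤ m := Nat.lt_succ_iff.mp (Finset.mem_range.mp hℓ)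
  have hc : ((m + 1).choose ℓ : ℂ) * ((m : ℂ) + 1 - ℓ) = ((m : ℂ) + 1) * (m.choose ℓ : ℂ) := by
    have h := Nat.choose_mul_succ_eq m ℓ
    have h' : ((m.choose ℓ * (m + 1) : ℕ) : ℂ) = (((m + 1).choose ℓ * (m + 1 - ℓ) : ℕ) : ℂ) :=
      congrArg _ h
    rw [Nat.cast_mul, Nat.cast_mul, Nat.cast_sub (by omega)] at h'
    push_cast at h'
    linear_combination -h'
  rw [Complex.one_div_Gamma_eq_self_mul_one_div_Gamma_add_one]
  have harg : ((ℓ : ℂ) - ((m + 1 : ℕ) : ℂ)) / 2 + 1 = (1 - (m : ℂ) + ℓ) / 2 := by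
    push_cast; ring
  rw [harg]
  push_cast
  linear_combination (-(1 / 2) * Complex.Gamma (((ℓ : ℂ) - a) / 2) *
    (Complex.Gamma ((1 - (m : ℂ) + ℓ) / 2))⁻¹) * hc

lemma gammaRatioClosedForm_one {a : ℂ} (ha : a ≠ 0) :
    gammaRatioClosedForm 1 a = gammaRatioClosedForm 0 (a - 1) := by
  have h2 : (2 : ℂ) ^ a = 2 * 2 ^ (a - 1) := by
    rw [Complex.cpow_sub _ _ two_ne_zero, Complex.cpow_one]; ring
  have hG : Complex.Gamma ((1 + a + (1 : ℕ)) / 2) = a / 2 * Complex.Gamma (a / 2) := by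
    rw [← Complex.Gamma_add_one _ (div_ne_zero ha two_ne_zero)]; congr 1; push_cast; ring
  have hG' : Complex.Gamma (1 + a) = a * Complex.Gamma a := by
    rw [add_comm, Complex.Gamma_add_one _ ha]
  rw [gammaRatioClosedForm, gammaRatioClosedForm, h2, hG, hG', Nat.cast_one, Nat.cast_zero,
    sub_zero, add_zero, add_sub_cancel]
  field_simp

lemma gammaRatioClosedForm_add_two (m : ℕ) {a : ℂ} (ha : a ≠ 0) (ham : a + m + 1 ≠ 0) :
    gammaRatioClosedForm (m + 2) a =
      gammaRatioClosedForm (m + 1) (a - 1) - ((m : ℂ) + 1) / 2 * gammaRatioClosedForm m a := by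
  have h2 : (2 : ℂ) ^ a = 2 * 2 ^ (a - 1) := by
    rw [Complex.cpow_sub _ _ two_ne_zero, Complex.cpow_one]; ring
  have hG : Complex.Gamma ((1 + a + (m + 2 : ℕ)) / 2) =
      (a + m + 1) / 2 * Complex.Gamma ((1 + a + m) / 2) := by
    have h := Complex.Gamma_add_one _ (div_ne_zero ham two_ne_zero)
    rw [show (1 + a + (m + 2 : ℕ)) / 2 = (a + m + 1) / 2 + 1 by push_cast; ring, h,
      show 1 + a + m = a + m + 1 by ring]
  have hG' : Complex.Gamma (1 + a) = a * Complex.Gamma a := by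
    rw [add_comm, Complex.Gamma_add_one _ ha]
  have hs : Complex.sin ((Real.pi : ℂ) * (a - (m + 2 : ℕ)) / 2) =
      -Complex.sin ((Real.pi : ℂ) * (a - m) / 2) := by
    rw [← Complex.sin_sub_pi]; congr 1; push_cast; ring
  have hs' : (Real.pi : ℂ) * (a - 1 - (m + 1 : ℕ)) / 2 = Real.pi * (a - (m + 2 : ℕ)) / 2 := by
    push_cast; ring
  have hg' : (1 + (a - 1) + (m + 1 : ℕ)) / 2 = (1 + a + m) / 2 := by push_cast; ring
  simp only [gammaRatioClosedForm]
  rw [hs', hg', hs, hG, hG', h2, add_sub_cancel]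
  field_simp
  ring

lemma gammaRatioSum_zero_eq {a : ℂ} (ha : ∀ n : ℤ, a ≠ (n : ℂ)) :
    gammaRatioSum 0 a = gammaRatioClosedForm 0 a := by
  have hπ : (Real.pi : ℂ) ≠ 0 := Complex.ofReal_ne_zero.mpr Real.pi_ne_zero
  have hs : Complex.sin (Real.pi * a / 2) ≠ 0 := by
    rw [Complex.sin_ne_zero_iff]
    intro k hk
    refine ha (2 * k) ?_
    have : (Real.pi : ℂ) * a = Real.pi * (2 * k) := by linear_combination 2 * hk
    exact_mod_cast mul_left_cancel₀ hπ this
  have hG : Complex.Gamma (1 + a) ≠ 0 := Complex.Gamma_ne_zero fun n hn ↦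
    ha (-n - 1) (by push_cast; linear_combination hn)
  have hG' : Complex.Gamma (1 + a / 2) ≠ 0 := Complex.Gamma_ne_zero fun n hn ↦
    ha (-2 * n - 2) (by push_cast; linear_combination 2 * hn)
  have hhalf : Complex.Gamma (1 / 2) ≠ 0 := Complex.Gamma_ne_zero_of_re_pos (by norm_num)
  have hdup := Complex.Gamma_mul_Gamma_add_half ((1 + a) / 2)
  rw [show (1 + a) / 2 + 1 / 2 = 1 + a / 2 by ring, show 2 * ((1 + a) / 2) = 1 + a by ring,
    show 1 - (1 + a) = -a by ring, Complex.cpow_neg] at hdup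
  have hrefl := Complex.Gamma_mul_Gamma_one_sub (-(a / 2))
  rw [show 1 - -(a / 2) = 1 + a / 2 by ring,
    show (Real.pi : ℂ) * -(a / 2) = -(Real.pi * a / 2) by ring, Complex.sin_neg] at hrefl
  have hsq : Complex.Gamma (1 / 2) * (√Real.pi : ℝ) = Real.pi := by
    rw [Complex.Gamma_one_half_eq, ← Complex.ofReal_ofNat, ← Complex.ofReal_one,
      ← Complex.ofReal_div, ← Complex.ofReal_cpow Real.pi_pos.le, ← Real.sqrt_eq_rpow,
      ← Complex.ofReal_mul, Real.mul_self_sqrt Real.pi_pos.le]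
  have h2 : (2 : ℂ) ^ a ≠ 0 := by simp [Complex.cpow_eq_zero_iff]
  simp only [gammaRatioSum, gammaRatioClosedForm, zero_add, Finset.sum_range_one, Nat.choose_self,
    Nat.cast_one, Nat.cast_zero, sub_zero, add_zero, one_mul, zero_sub, neg_div]
  rw [← div_eq_mul_inv, div_eq_div_iff hhalf (mul_ne_zero hG hs)]
  refine mul_right_cancel₀ hG' ?_
  have hrefl' : Complex.Gamma (-(a / 2)) * Complex.Gamma (1 + a / 2) *
      Complex.sin (Real.pi * a / 2) = -Real.pi := by
    rw [hrefl, div_neg, neg_mul, div_mul_cancel₀ _ hs]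
  have hdup' : Complex.Gamma ((1 + a) / 2) * Complex.Gamma (1 + a / 2) * 2 ^ a =
      Complex.Gamma (1 + a) * (√Real.pi : ℝ) := by
    rw [hdup, mul_right_comm, inv_mul_cancel_right₀ h2]
  linear_combination Complex.Gamma (1 + a) * hrefl' + Complex.Gamma (1 / 2) * hdup' +
    Complex.Gamma (1 + a) * hsq

lemma gammaRatioSum_eq (m : ℕ) {a : ℂ} (ha : ∀ n : ℤ, a ≠ (n : ℂ)) :
    gammaRatioSum m a = gammaRatioClosedForm m a := by
  induction m using Nat.twoStepInduction generalizing a with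
  | zero => exact gammaRatioSum_zero_eq ha
  | one =>
    rw [gammaRatioSum_one, gammaRatioClosedForm_one (by simpa using ha 0)]
    exact gammaRatioSum_zero_eq fun n hn ↦ ha (n + 1) (by push_cast; linear_combination hn)
  | more m ih ih' =>
    rw [gammaRatioSum_add_two, gammaRatioClosedForm_add_two m (by simpa using ha 0)
      (fun h ↦ ha (-m - 1) (by push_cast; linear_combination h)), ih ha,
      ih' fun n hn ↦ ha (n + 1) (by push_cast; linear_combination hn)]

/-- Evaluation of the binomial sum of ratios of Gamma functions via Gauss's theorem.
Note that Mathlib's `Complex.Gamma` vanishes at the poles (the nonpositive integers), so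
`(Complex.Gamma z)⁻¹ = 0` there, matching the stated convention. -/
theorem binomial_gamma_sum (m : ℕ) (ε : ℂ) (hε : ε = 1 ∨ ε = -1) (a : ℂ)
    (ha : ∀ n : ℤ, a ≠ (n : ℂ)) :
    ∑ ℓ ∈ Finset.range (m + 1),
        ε ^ ℓ * (m.choose ℓ : ℂ) * Complex.Gamma (((ℓ : ℂ) - a) / 2) *
          (Complex.Gamma ((1 - (m : ℂ) + (ℓ : ℂ)) / 2))⁻¹ =
      -ε ^ m * (2 : ℂ) ^ a * Complex.Gamma ((1 + a + (m : ℂ)) / 2) /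
        (Complex.Gamma (1 + a) * Complex.sin ((Real.pi : ℂ) * (a - (m : ℂ)) / 2)) := by
  have h : ∑ ℓ ∈ Finset.range (m + 1),
      ε ^ ℓ * (m.choose ℓ : ℂ) * Complex.Gamma (((ℓ : ℂ) - a) / 2) *
        (Complex.Gamma ((1 - (m : ℂ) + (ℓ : ℂ)) / 2))⁻¹ = ε ^ m * gammaRatioSum m a := by
    rw [gammaRatioSum, Finset.mul_sum]
    refine Finset.sum_congr rfl fun ℓ hℓ ↦ ?_
    linear_combination ((m.choose ℓ : ℂ) * Complex.Gamma (((ℓ : ℂ) - a) / 2)) *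
      sign_pow_mul_inv_Gamma (Nat.lt_succ_iff.mp (Finset.mem_range.mp hℓ)) hε
  rw [h, gammaRatioSum_eq m ha, gammaRatioClosedForm]
  ring
end

section
/- For every ε ∈ {1,−1} and every z ∈ ℂ ∖ ℤ, one has Γ(z/2)/Γ((1−z)/2) + ε·i·Γ((1+z)/2)/Γ(1−z/2) = (2^{1−z}/√π) · Γ(z) · exp(ε·i·π·z/2). -/
open Complex Real

/-- A duplication-type identity for ratios of Gamma functions. -/
theorem gamma_ratio_identity (ε : ℂ) (hε : ε = 1 ∨ ε = -1) (z : ℂ)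
    (hz : ∀ n : ℤ, z ≠ (n : ℂ)) :
    Complex.Gamma (z / 2) / Complex.Gamma ((1 - z) / 2) +
        ε * Complex.I * Complex.Gamma ((1 + z) / 2) / Complex.Gamma (1 - z / 2) =
      (2 : ℂ) ^ (1 - z) / (Real.sqrt Real.pi : ℂ) * Complex.Gamma z *
        Complex.exp (ε * Complex.I * (Real.pi : ℂ) * z / 2) := by
  have hA : Complex.Gamma (z / 2) ≠ 0 := Complex.Gamma_ne_zero fun m h =>
    hz (-2 * m) (by push_cast; linear_combination 2 * h)
  have hB : Complex.Gamma ((1 + z) / 2) ≠ 0 := Complex.Gamma_ne_zero fun m h =>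
    hz (-2 * m - 1) (by push_cast; linear_combination 2 * h)
  have hC : Complex.Gamma ((1 - z) / 2) ≠ 0 := Complex.Gamma_ne_zero fun m h =>
    hz (2 * m + 1) (by push_cast; linear_combination -2 * h)
  have hD : Complex.Gamma (1 - z / 2) ≠ 0 := Complex.Gamma_ne_zero fun m h =>
    hz (2 * m + 2) (by push_cast; linear_combination -2 * h)
  have hpi : (Real.pi : ℂ) ≠ 0 := Complex.ofReal_ne_zero.mpr Real.pi_ne_zero
  have hsqrt : (Real.sqrt Real.pi : ℂ) ^ 2 = Real.pi := by
    rw [← Complex.ofReal_pow, Real.sq_sqrt Real.pi_pos.le]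
  have hsqrt_ne : (Real.sqrt Real.pi : ℂ) ≠ 0 :=
    Complex.ofReal_ne_zero.mpr (Real.sqrt_pos.mpr Real.pi_pos).ne'
  have hsin := Complex.Gamma_mul_Gamma_one_sub (z / 2)
  have hcos := Complex.Gamma_mul_Gamma_one_sub ((1 + z) / 2)
  rw [show 1 - (1 + z) / 2 = (1 - z) / 2 by ring,
    show (Real.pi : ℂ) * ((1 + z) / 2) = Real.pi * (z / 2) + Real.pi / 2 by ring,
    Complex.sin_add_pi_div_two] at hcos
  have hdup := Complex.Gamma_mul_Gamma_add_half (z / 2)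
  rw [show z / 2 + 1 / 2 = (1 + z) / 2 by ring, mul_div_cancel₀ z two_ne_zero] at hdup
  have hexp : Complex.exp (ε * Complex.I * (Real.pi : ℂ) * z / 2) =
      Complex.cos (Real.pi * (z / 2)) + ε * Complex.I * Complex.sin (Real.pi * (z / 2)) := by
    rcases hε with rfl | rfl
    · rw [show 1 * Complex.I * (Real.pi : ℂ) * z / 2 = Real.pi * (z / 2) * Complex.I by ring,
        Complex.exp_mul_I]
      ring
    · rw [show -1 * Complex.I * (Real.pi : ℂ) * z / 2 = -(Real.pi * (z / 2)) * Complex.I by ring,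
        Complex.exp_mul_I, Complex.cos_neg, Complex.sin_neg]
      ring
  have hs : Complex.sin (Real.pi * (z / 2)) ≠ 0 := fun h =>
    mul_ne_zero hA hD (by rw [hsin, h, div_zero])
  have hc : Complex.cos (Real.pi * (z / 2)) ≠ 0 := fun h =>
    mul_ne_zero hB hC (by rw [hcos, h, div_zero])
  rw [eq_div_iff hs] at hsin
  rw [eq_div_iff hc] at hcos
  have hfirst : Complex.Gamma (z / 2) / Complex.Gamma ((1 - z) / 2) =
      Complex.Gamma (z / 2) * Complex.Gamma ((1 + z) / 2) *
        Complex.cos (Real.pi * (z / 2)) / Real.pi := by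
    rw [div_eq_div_iff hC hpi]
    linear_combination -Complex.Gamma (z / 2) * hcos
  have hsecond : Complex.Gamma ((1 + z) / 2) / Complex.Gamma (1 - z / 2) =
      Complex.Gamma (z / 2) * Complex.Gamma ((1 + z) / 2) *
        Complex.sin (Real.pi * (z / 2)) / Real.pi := by
    rw [div_eq_div_iff hD hpi]
    linear_combination -Complex.Gamma ((1 + z) / 2) * hsin
  rw [mul_div_assoc, hfirst, hsecond, hdup, hexp, ← hsqrt]
  field_simp
end
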